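/- arXiv:2012.08633 — 11 statements merged into one kernel-verified Lean document; each statement's English description precedes it below -/
import Mathlib

section
/- Let n ≥ 2 and let w : Finset (Fin n) → ℝⁿ be a realized oriented cube. Then there exists a unique point O ∈ ℝⁿ such that for every A : Finset (Fin n), O lies on the open segment joining w A and w Aᶜ (the segment joining each vertex to its opposite vertex); moreover this common point O, called the center of w, lies in the interior of the convex hull of the range of w. -/
/-- A set `S` of cube-vertex indices spans an affine hyperplane flat of the
configuration `w`: the affine span of `w '' S` has dimension `n - 1` and
contains no other point of the family. -/
def IsHypFlat (n : ℕ) (w : Finset (Fin n) → (Fin n → ℝ)) (S : Set (Finset (Fin n))) : Prop :=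
  Module.finrank ℝ (affineSpan ℝ (w '' S)).direction = n - 1 ∧
    Set.range w ∩ (affineSpan ℝ (w '' S) : Set (Fin n → ℝ)) = w '' S

/-- A family `w : Finset (Fin n) → ℝⁿ` is a realized oriented cube. -/
structure IsRealizedCube (n : ℕ) (w : Finset (Fin n) → (Fin n → ℝ)) : Prop where
  inj : Function.Injective w
  span_top : affineSpan ℝ (Set.range w) = ⊤
  triples : ∀ A B C : Finset (Fin n), A ≠ B → A ≠ C → B ≠ C →
    AffineIndependent ℝ ![w A, w B, w C]
  rect : ∀ D B C : Finset (Fin n), Disjoint B C → B.Nonempty → C.Nonempty →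
    (openSegment ℝ (w D) (w (symmDiff D (B ∪ C))) ∩
      openSegment ℝ (w (symmDiff D B)) (w (symmDiff D C))).Nonempty
  facet_pos : ∀ i : Fin n, IsHypFlat n w {A | i ∉ A}
  facet_neg : ∀ i : Fin n, IsHypFlat n w {A | i ∈ A}
  skew_pos : ∀ i j : Fin n, i ≠ j → IsHypFlat n w {A | i ∈ A ↔ j ∈ A}
  skew_neg : ∀ i j : Fin n, i ≠ j → IsHypFlat n w {A | i ∈ A ↔ j ∉ A}

theorem aux_sub {n : ℕ} (P : AffineSubspace ℝ (Fin n → ℝ)) (a b p q : Fin n → ℝ)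
    (ha : a ∉ P) (hp : p ∈ openSegment ℝ a b) (hq : q ∈ openSegment ℝ a b)
    (hpP : p ∈ P) (hqP : q ∈ P) : p = q := by
  rw [openSegment_eq_image_lineMap] at hp hq
  obtain ⟨s, hs, rfl⟩ := hp
  obtain ⟨t, ht, rfl⟩ := hq
  by_contra hne
  have hst : s ≠ t := fun h => hne (by rw [h])
  apply ha
  have h := AffineMap.lineMap_mem (s / (s - t)) hpP hqP
  have h0 : s - t ≠ 0 := sub_ne_zero.mpr hst
  convert h using 1
  ext i
  simp only [AffineMap.lineMap_apply, Pi.add_apply, Pi.smul_apply, vsub_eq_sub, vadd_eq_add,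
    Pi.sub_apply, smul_eq_mul]
  field_simp
  ring

theorem aux_mem {n : ℕ} (P : AffineSubspace ℝ (Fin n → ℝ)) (a b p : Fin n → ℝ)
    (ha : a ∈ P) (hb : b ∈ P) (hp : p ∈ openSegment ℝ a b) : p ∈ P := by
  rw [openSegment_eq_image_lineMap] at hp
  obtain ⟨s, hs, rfl⟩ := hp
  exact AffineMap.lineMap_mem s ha hb

theorem aux_end {n : ℕ} (P : AffineSubspace ℝ (Fin n → ℝ)) (a b p : Fin n → ℝ)
    (ha : a ∈ P) (hpP : p ∈ P) (hp : p ∈ openSegment ℝ a b) : b ∈ P := by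
  rw [openSegment_eq_image_lineMap] at hp
  obtain ⟨s, hs, rfl⟩ := hp
  have h := AffineMap.lineMap_mem (1 / s) ha hpP
  have h0 : s ≠ 0 := hs.1.ne'
  convert h using 1
  ext i
  simp only [AffineMap.lineMap_apply, Pi.add_apply, Pi.smul_apply, vsub_eq_sub, vadd_eq_add,
    Pi.sub_apply, smul_eq_mul]
  field_simp
  ring

theorem aux_cross {n : ℕ} {w : Finset (Fin n) → (Fin n → ℝ)} (hw : IsRealizedCube n w)
    (A B : Finset (Fin n)) (h1 : A ≠ B) (h2 : A ≠ Bᶜ) :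
    ∃ p, p ∈ openSegment ℝ (w A) (w Aᶜ) ∧ p ∈ openSegment ℝ (w B) (w Bᶜ) := by
  have hn1 : (symmDiff A B).Nonempty := by
    rw [Finset.nonempty_iff_ne_empty]
    intro h
    exact h1 (symmDiff_eq_bot.mp h)
  have hn2 : (symmDiff A B)ᶜ.Nonempty := by
    rw [Finset.nonempty_iff_ne_empty]
    intro h
    apply h2
    ext x
    have := congrArg (fun S => x ∈ S) h
    simp [Finset.mem_symmDiff] at this ⊢
    tauto
  obtain ⟨p, hp, hq⟩ := hw.rect A (symmDiff A B) (symmDiff A B)ᶜ disjoint_compl_right hn1 hn2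
  refine ⟨p, ?_, ?_⟩
  · convert hp using 2
    congr 1
    ext x
    simp only [Finset.mem_symmDiff, Finset.mem_compl, Finset.mem_union]
    tauto
  · convert hq using 2
    · ext x
      simp [Finset.mem_symmDiff]
    · congr 1
      ext x
      simp [Finset.mem_symmDiff]
      tauto

theorem aux_uniq {n : ℕ} (hn : 2 ≤ n) {w : Finset (Fin n) → (Fin n → ℝ)}
    (hw : IsRealizedCube n w)
    (A B : Finset (Fin n)) (h1 : A ≠ B) (h2 : A ≠ Bᶜ) (p q : Fin n → ℝ)
    (hpA : p ∈ openSegment ℝ (w A) (w Aᶜ)) (hpB : p ∈ openSegment ℝ (w B) (w Bᶜ))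
    (hqA : q ∈ openSegment ℝ (w A) (w Aᶜ)) (hqB : q ∈ openSegment ℝ (w B) (w Bᶜ)) : p = q := by
  have h3 : B ≠ Bᶜ := by
    intro h
    have := congrArg (fun S => (⟨0, by omega⟩ : Fin n) ∈ S) h
    simp at this
  have hB := left_mem_affineSpan_pair ℝ (w B) (w Bᶜ)
  have hB' := right_mem_affineSpan_pair ℝ (w B) (w Bᶜ)
  refine aux_sub (line[ℝ, w B, w Bᶜ]) (w A) (w Aᶜ) p q ?_ hpA hqA
    (aux_mem _ _ _ _ hB hB' hpB) (aux_mem _ _ _ _ hB hB' hqB)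
  intro hmem
  have ht := hw.triples A B Bᶜ h1 h2 h3
  rw [affineIndependent_iff_not_collinear_set] at ht
  exact ht (collinear_insert_of_mem_affineSpan_pair hmem)

theorem aux_interior {n : ℕ} {w : Finset (Fin n) → (Fin n → ℝ)}
    (hw : IsRealizedCube n w) (O : Fin n → ℝ)
    (hO : ∀ A : Finset (Fin n), O ∈ openSegment ℝ (w A) (w Aᶜ)) :
    O ∈ interior (convexHull ℝ (Set.range w)) := by
  by_contra hcon
  have hne : (interior (convexHull ℝ (Set.range w))).Nonempty :=
    interior_convexHull_nonempty_iff_affineSpan_eq_top.mpr hw.span_top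
  have hconv : Convex ℝ (convexHull ℝ (Set.range w)) := convex_convexHull ℝ _
  obtain ⟨f, hf⟩ := geometric_hahn_banach_open_point hconv.interior isOpen_interior hcon
  have hle : ∀ x ∈ convexHull ℝ (Set.range w), f x ≤ f O := by
    intro x hx
    have hx' : x ∈ closure (interior (convexHull ℝ (Set.range w))) := by
      rw [hconv.closure_interior_eq_closure_of_nonempty_interior hne]
      exact subset_closure hx
    exact closure_minimal (fun y hy => (hf y hy).le)
      (isClosed_le f.continuous continuous_const) hx'
  have hleA : ∀ A, f (w A) ≤ f O := fun A => hle _ (subset_convexHull ℝ _ ⟨A, rfl⟩)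
  have hge : ∀ A, f O ≤ f (w A) := by
    intro A
    obtain ⟨s, t, hs, ht, hst, h⟩ := hO A
    have hfO : f O = s * f (w A) + t * f (w Aᶜ) := by rw [← h]; simp
    have := hleA Aᶜ
    have h1 : s = 1 - t := by linarith
    subst h1
    by_contra hlt
    push Not at hlt
    nlinarith
  have hc : Convex ℝ {x | f O ≤ f x} := convex_halfSpace_ge f.toLinearMap.isLinear _
  have hsub : convexHull ℝ (Set.range w) ⊆ {x | f O ≤ f x} :=
    convexHull_min (by rintro _ ⟨A, rfl⟩; exact hge A) hc
  obtain ⟨x, hx⟩ := hne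
  have := hf x hx
  have h2 : f O ≤ f x := hsub (interior_subset hx)
  linarith

theorem cube_has_center (n : ℕ) (hn : 2 ≤ n) (w : Finset (Fin n) → (Fin n → ℝ))
    (hw : IsRealizedCube n w) :
    (∃! O : Fin n → ℝ, ∀ A : Finset (Fin n), O ∈ openSegment ℝ (w A) (w Aᶜ)) ∧
    ∀ O : Fin n → ℝ, (∀ A : Finset (Fin n), O ∈ openSegment ℝ (w A) (w Aᶜ)) →
      O ∈ interior (convexHull ℝ (Set.range w)) := by
  refine ⟨?_, fun O hO => aux_interior hw O hO⟩
  obtain ⟨B, hB⟩ : ∃ B : Finset (Fin n), B = {⟨0, by omega⟩} := ⟨_, rfl⟩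
  have h1 : (∅ : Finset (Fin n)) ≠ B := by
    rw [hB]; exact (Finset.singleton_ne_empty _).symm
  have h2 : (∅ : Finset (Fin n)) ≠ Bᶜ := by
    intro h
    have := congrArg (fun S => (⟨1, by omega⟩ : Fin n) ∈ S) h
    simp [hB] at this
  obtain ⟨O, hO1, hO2⟩ := aux_cross hw ∅ B h1 h2
  refine ⟨O, ?_, fun O' hO' => aux_uniq hn hw ∅ B h1 h2 O' O (hO' _) (hO' _) hO1 hO2⟩
  have hsymm : ∀ A, O ∈ openSegment ℝ (w Aᶜ) (w A) → O ∈ openSegment ℝ (w A) (w Aᶜ) :=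
    fun A h => by rwa [openSegment_symm]
  by_cases hn2 : n = 2
  · subst hn2
    intro A
    have hA : A = ∅ ∨ A = ∅ᶜ ∨ A = B ∨ A = Bᶜ := by
      have hB' : B = {0} := hB
      clear * - hB'
      subst hB'
      revert A; decide
    rcases hA with rfl | rfl | rfl | rfl
    · exact hO1
    · apply hsymm; rwa [compl_compl]
    · exact hO2
    · apply hsymm; rwa [compl_compl]
  obtain ⟨P, hP⟩ : ∃ P, P = affineSpan ℝ (Set.range ![O, w ∅, w B]) := ⟨_, rfl⟩
  have hPO : O ∈ P := hP ▸ mem_affineSpan ℝ ⟨0, rfl⟩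
  have hP1 : w ∅ ∈ P := hP ▸ mem_affineSpan ℝ ⟨1, rfl⟩
  have hP2 : w B ∈ P := hP ▸ mem_affineSpan ℝ ⟨2, rfl⟩
  have hP1' := aux_end P _ _ _ hP1 hPO hO1
  have hP2' := aux_end P _ _ _ hP2 hPO hO2
  have hout : ∀ A, w A ∉ P → O ∈ openSegment ℝ (w A) (w Aᶜ) := by
    intro A hA
    obtain ⟨p, hpA, hp1⟩ := aux_cross hw A ∅ (by rintro rfl; exact hA hP1)
      (by rintro rfl; exact hA hP1')
    obtain ⟨q, hqA, hq1⟩ := aux_cross hw A B (by rintro rfl; exact hA hP2)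
      (by rintro rfl; exact hA hP2')
    have hpq := aux_sub P _ _ p q hA hpA hqA (aux_mem P _ _ _ hP1 hP1' hp1)
      (aux_mem P _ _ _ hP2 hP2' hq1)
    subst hpq
    rwa [← aux_uniq hn hw ∅ B h1 h2 p O hp1 hq1 hO1 hO2]
  obtain ⟨E, hE⟩ : ∃ E, w E ∉ P := by
    by_contra hcon
    push Not at hcon
    have htop : P = ⊤ := by
      rw [eq_top_iff, ← hw.span_top]
      exact affineSpan_le.mpr (by rintro _ ⟨A, rfl⟩; exact hcon A)
    have hfr := finrank_vectorSpan_range_le ℝ ![O, w ∅, w B] (n := 2) (by simp)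
    rw [← direction_affineSpan, ← hP, htop, AffineSubspace.direction_top, finrank_top] at hfr
    simp at hfr
    omega
  intro A
  by_cases hA : w A ∈ P
  · by_cases hA' : w Aᶜ ∈ P
    · obtain ⟨r, hrE, hrA⟩ := aux_cross hw E A (by rintro rfl; exact hE hA)
        (by rintro rfl; exact hE hA')
      rwa [← aux_sub P _ _ r O hE hrE (hout E hE) (aux_mem P _ _ _ hA hA' hrA) hPO]
    · have := hout _ hA'
      rw [compl_compl] at this
      exact hsymm A this
  · exact hout A hA
end

section
/- Let n ≥ 3 and let w : Finset (Fin n) → ℝⁿ be a realized oriented cube with center O (the unique point lying on every open segment joining w A and w Aᶜ). Then: (a) for every i : Fin n there is a unique point Pᵢ lying on the open segment joining w A and w (Aᶜ.erase i) for every A with i ∉ A, and a unique point Qᵢ lying on the open segment joining w A and w (insert i Aᶜ) for every A with i ∈ A (the centers of the two facets in direction i); (b) for every i, O lies on the open segment joining Pᵢ and Qᵢ; (c) the family of vectors (Pᵢ − Qᵢ), i : Fin n, is linearly independent in ℝⁿ, so the 2n facet centers realize the n-dimensional cross-polytope. -/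
open scoped symmDiff

lemma cfc_mem_of_two {n : ℕ} (M : AffineSubspace ℝ (Fin n → ℝ)) {c d X Y : Fin n → ℝ}
    (hX : X ∈ segment ℝ c d) (hY : Y ∈ segment ℝ c d) (hne : X ≠ Y) (hXM : X ∈ M) (hYM : Y ∈ M) :
    c ∈ M ∧ d ∈ M := by
  rw [segment_eq_image_lineMap] at hX hY
  obtain ⟨s, -, rfl⟩ := hX
  obtain ⟨t, -, rfl⟩ := hY
  have hst : t - s ≠ 0 := by
    intro h
    apply hne
    rw [sub_eq_zero.mp h]
  have h1 := AffineMap.lineMap_mem (-s / (t - s)) hXM hYM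
  have h2 := AffineMap.lineMap_mem ((1 - s) / (t - s)) hXM hYM
  constructor
  · convert h1 using 1
    ext k
    simp only [AffineMap.lineMap_apply_module, Pi.add_apply, Pi.smul_apply, smul_eq_mul]
    field_simp
    ring
  · convert h2 using 1
    ext k
    simp only [AffineMap.lineMap_apply_module, Pi.add_apply, Pi.smul_apply, smul_eq_mul]
    field_simp
    ring

lemma cfc_seg {n : ℕ} {p q z : Fin n → ℝ} (O : Fin n → ℝ) (h : z ∈ openSegment ℝ p q) :
    ∃ a b : ℝ, 0 < a ∧ 0 < b ∧ z - O = a • (p - O) + b • (q - O) := by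
  obtain ⟨a, b, ha, hb, hab, rfl⟩ := h
  refine ⟨a, b, ha, hb, ?_⟩
  ext k
  simp only [Pi.sub_apply, Pi.add_apply, Pi.smul_apply, smul_eq_mul]
  linear_combination O k * hab

lemma cfc_unique {n : ℕ} {w : Finset (Fin n) → (Fin n → ℝ)} (hw : IsRealizedCube n w)
    {A A' B B' : Finset (Fin n)} (h1 : A ≠ A') (h2 : A ≠ B) (h3 : A' ≠ B) {X Y : Fin n → ℝ}
    (hXA : X ∈ openSegment ℝ (w A) (w A')) (hXB : X ∈ openSegment ℝ (w B) (w B'))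
    (hYA : Y ∈ openSegment ℝ (w A) (w A')) (hYB : Y ∈ openSegment ℝ (w B) (w B')) : X = Y := by
  by_contra hne
  have hX : X ∈ affineSpan ℝ ({X, Y} : Set (Fin n → ℝ)) := mem_affineSpan ℝ (by simp)
  have hY : Y ∈ affineSpan ℝ ({X, Y} : Set (Fin n → ℝ)) := mem_affineSpan ℝ (by simp)
  have hA := cfc_mem_of_two _ (openSegment_subset_segment _ _ _ hXA)
    (openSegment_subset_segment _ _ _ hYA) hne hX hY
  have hB := cfc_mem_of_two _ (openSegment_subset_segment _ _ _ hXB)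
    (openSegment_subset_segment _ _ _ hYB) hne hX hY
  have := hw.triples A A' B h1 h2 h3
  rw [affineIndependent_iff_not_collinear_set] at this
  exact this (collinear_triple_of_mem_affineSpan_pair hA.1 hA.2 hB.1)

lemma cfc_conc {n : ℕ} {w : Finset (Fin n) → (Fin n → ℝ)} (hw : IsRealizedCube n w)
    (S : Set (Finset (Fin n))) (F : Finset (Fin n)) (hFne : F.Nonempty)
    (hF : ∀ A ∈ S, A ∆ F ∈ S) (hsub : ∀ A ∈ S, ∀ B ∈ S, A ∆ B ⊆ F)
    (A B : Finset (Fin n)) (hA : A ∈ S) (hB : B ∈ S) (hBA : B ≠ A) (hBA' : B ≠ A ∆ F)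
    (hdim : ∀ C ∈ S, C ≠ A → C ≠ A ∆ F → C ≠ B → C ≠ B ∆ F →
      2 < Module.finrank ℝ (affineSpan ℝ (w '' S)).direction) :
    ∃! P : Fin n → ℝ, ∀ C ∈ S, P ∈ openSegment ℝ (w C) (w (C ∆ F)) := by
  have hself : ∀ C : Finset (Fin n), C ≠ C ∆ F := by
    intro C h
    have : F = ∅ := by simpa using (symmDiff_eq_left.mp h.symm)
    exact hFne.ne_empty this
  have hinv : ∀ C : Finset (Fin n), (C ∆ F) ∆ F = C := fun C => symmDiff_symmDiff_cancel_right F C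
  have cross : ∀ C ∈ S, ∀ D ∈ S, D ≠ C → D ≠ C ∆ F →
      ∃ X, X ∈ openSegment ℝ (w C) (w (C ∆ F)) ∧ X ∈ openSegment ℝ (w D) (w (D ∆ F)) := by
    intro C hC D hD h1 h2
    have hs := hsub C hC D hD
    have hne1 : (C ∆ D).Nonempty := by
      rw [Finset.nonempty_iff_ne_empty]
      intro h
      exact h1 (symmDiff_eq_bot.mp h).symm
    have hne2 : (F \ (C ∆ D)).Nonempty := by
      rw [Finset.sdiff_nonempty]
      intro h
      have : C ∆ D = F := Finset.Subset.antisymm hs h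
      apply h2
      rw [← this, symmDiff_symmDiff_cancel_left]
    have := hw.rect C (C ∆ D) (F \ (C ∆ D)) Finset.disjoint_sdiff hne1 hne2
    rw [Finset.union_sdiff_of_subset hs, symmDiff_symmDiff_cancel_left] at this
    have e : C ∆ (F \ (C ∆ D)) = D ∆ F := by
      ext x
      have := @hs x
      simp only [Finset.mem_symmDiff, Finset.mem_sdiff] at this ⊢
      tauto
    rw [e] at this
    exact this
  obtain ⟨P, hPA, hPB⟩ := cross A hA B hB hBA hBA'
  refine ⟨P, ?_, ?_⟩
  swap
  · intro Y hY
    exact cfc_unique hw (hself A) hBA.symm hBA'.symm (hY A hA) (hY B hB) hPA hPB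
  intro C hC
  by_contra hPC
  have sw : ∀ D : Finset (Fin n), ∀ X, X ∈ openSegment ℝ (w D) (w (D ∆ F)) →
      X ∈ openSegment ℝ (w (D ∆ F)) (w ((D ∆ F) ∆ F)) := by
    intro D X h
    rw [hinv, openSegment_symm]; exact h
  have hCA : C ≠ A := by rintro rfl; exact hPC hPA
  have hCB : C ≠ B := by rintro rfl; exact hPC hPB
  have hCA' : C ≠ A ∆ F := by rintro rfl; exact hPC (sw _ _ hPA)
  have hCB' : C ≠ B ∆ F := by rintro rfl; exact hPC (sw _ _ hPB)
  have h2 := hdim C hC hCA hCA' hCB hCB'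
  set M := affineSpan ℝ (Set.range ![P, w A, w B]) with hM
  have hMdim : Module.finrank ℝ M.direction ≤ 2 := by
    rw [hM, direction_affineSpan]
    exact finrank_vectorSpan_range_le ℝ _ (by simp)
  have hPM : P ∈ M := mem_affineSpan ℝ ⟨0, rfl⟩
  have hAM : w A ∈ M := mem_affineSpan ℝ ⟨1, rfl⟩
  have hBM : w B ∈ M := mem_affineSpan ℝ ⟨2, rfl⟩
  have hnotend : ∀ D : Finset (Fin n), ∀ X, X ∈ openSegment ℝ (w D) (w (D ∆ F)) → w D ≠ X := by
    intro D X hX h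
    rw [← h] at hX
    rw [left_mem_openSegment_iff] at hX
    exact hself D (hw.inj hX)
  have segsub : ∀ D : Finset (Fin n), ∀ X, X ∈ openSegment ℝ (w D) (w (D ∆ F)) →
      X ∈ segment ℝ (w D) (w (D ∆ F)) := fun D X h => openSegment_subset_segment _ _ _ h
  have hAM' : w (A ∆ F) ∈ M :=
    (cfc_mem_of_two M (left_mem_segment ℝ _ _) (segsub _ _ hPA) (hnotend _ _ hPA) hAM hPM).2
  have hBM' : w (B ∆ F) ∈ M :=
    (cfc_mem_of_two M (left_mem_segment ℝ _ _) (segsub _ _ hPB) (hnotend _ _ hPB) hBM hPM).2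
  have inM : ∀ D : Finset (Fin n), w D ∈ M → w (D ∆ F) ∈ M → ∀ X,
      X ∈ openSegment ℝ (w D) (w (D ∆ F)) → X ∈ M := by
    intro D h1 h2 X hX
    exact M.convex.segment_subset h1 h2 (segsub _ _ hX)
  have main : ∀ D ∈ S, D ≠ A → D ≠ A ∆ F → D ≠ B → D ≠ B ∆ F →
      P ∉ openSegment ℝ (w D) (w (D ∆ F)) → w D ∈ M ∧ w (D ∆ F) ∈ M := by
    intro D hD h1 h2 h3 h4 hP
    obtain ⟨X, hXA, hXD⟩ := cross A hA D hD h1 h2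
    obtain ⟨Y, hYB, hYD⟩ := cross B hB D hD h3 h4
    refine cfc_mem_of_two M (segsub _ _ hXD) (segsub _ _ hYD) ?_ (inM _ hAM hAM' _ hXA)
      (inM _ hBM hBM' _ hYB)
    rintro rfl
    have := cfc_unique hw (hself A) hBA.symm hBA'.symm hPA hPB hXA hYB
    exact hP (this ▸ hXD)
  obtain ⟨hCM, hCM'⟩ := main C hC hCA hCA' hCB hCB' hPC
  have all : ∀ D ∈ S, w D ∈ M := by
    intro D hD
    by_cases h1 : D = A
    · exact h1 ▸ hAM
    by_cases h2 : D = A ∆ F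
    · exact h2 ▸ hAM'
    by_cases h3 : D = B
    · exact h3 ▸ hBM
    by_cases h4 : D = B ∆ F
    · exact h4 ▸ hBM'
    by_cases h5 : D = C
    · exact h5 ▸ hCM
    by_cases h6 : D = C ∆ F
    · exact h6 ▸ hCM'
    by_cases hP : P ∈ openSegment ℝ (w D) (w (D ∆ F))
    · obtain ⟨X, hXC, hXD⟩ := cross C hC D hD h5 h6
      refine (cfc_mem_of_two M (segsub _ _ hP) (segsub _ _ hXD) ?_ hPM (inM _ hCM hCM' _ hXC)).1
      rintro rfl
      exact hPC hXC
    · exact (main D hD h1 h2 h3 h4 hP).1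
  have hle : affineSpan ℝ (w '' S) ≤ M := by
    rw [affineSpan_le]
    rintro _ ⟨D, hD, rfl⟩
    exact all D hD
  have := Submodule.finrank_mono (AffineSubspace.direction_le hle)
  omega

lemma cfc_mid {n : ℕ} (hn : 3 ≤ n) {w : Finset (Fin n) → (Fin n → ℝ)} (hw : IsRealizedCube n w)
    {O : Fin n → ℝ} (hO : ∀ A : Finset (Fin n), O ∈ openSegment ℝ (w A) (w Aᶜ))
    (i : Fin n) (P Q : Fin n → ℝ)
    (hP : ∀ A : Finset (Fin n), i ∉ A → P ∈ openSegment ℝ (w A) (w (Aᶜ.erase i)))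
    (hQ : ∀ A : Finset (Fin n), i ∈ A → Q ∈ openSegment ℝ (w A) (w (insert i Aᶜ))) :
    O ∈ openSegment ℝ P Q := by
  have opp : ∀ A : Finset (Fin n), ∃ s : ℝ, 0 < s ∧ w Aᶜ - O = -(s • (w A - O)) := by
    intro A
    obtain ⟨a, b, ha, hb, h⟩ := cfc_seg O (hO A)
    refine ⟨a / b, by positivity, ?_⟩
    ext k
    have := congrFun h k
    simp only [Pi.sub_apply, Pi.add_apply, Pi.smul_apply, Pi.neg_apply, smul_eq_mul] at this ⊢
    field_simp
    linear_combination -this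
  have key : ∀ A : Finset (Fin n), i ∉ A → ∃ x y z t : ℝ, 0 < x ∧ 0 < y ∧ 0 < z ∧ 0 < t ∧
      P - O = x • (w A - O) + y • (w (Aᶜ.erase i) - O) ∧
      Q - O = -(z • (w A - O) + t • (w (Aᶜ.erase i) - O)) := by
    intro A hA
    obtain ⟨x, y, hx, hy, h1⟩ := cfc_seg O (hP A hA)
    obtain ⟨z, t, hz, ht, h2⟩ := cfc_seg O (hQ Aᶜ (by simpa using hA))
    obtain ⟨s, hs, h3⟩ := opp A
    obtain ⟨r, hr, h4⟩ := opp (Aᶜ.erase i)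
    have e : (Aᶜ.erase i)ᶜ = insert i Aᶜᶜ := by
      ext k; simp [Finset.mem_insert]
    rw [e] at h4
    refine ⟨x, y, z * s, t * r, hx, hy, by positivity, by positivity, h1, ?_⟩
    rw [h2, h3, h4]
    module
  by_cases hdet : ∃ A : Finset (Fin n), i ∉ A ∧ ∃ x y z t : ℝ, 0 < x ∧ 0 < y ∧ 0 < z ∧ 0 < t ∧
      P - O = x • (w A - O) + y • (w (Aᶜ.erase i) - O) ∧
      Q - O = -(z • (w A - O) + t • (w (Aᶜ.erase i) - O)) ∧ x * t = y * z
  · obtain ⟨A, hA, x, y, z, t, hx, hy, hz, ht, h1, h2, h3⟩ := hdet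
    refine ⟨z / (x + z), x / (x + z), by positivity, by positivity, by field_simp; ring, ?_⟩
    ext k
    have e1 := congrFun h1 k
    have e2 := congrFun h2 k
    simp only [Pi.sub_apply, Pi.add_apply, Pi.smul_apply, Pi.neg_apply, smul_eq_mul] at e1 e2 ⊢
    field_simp
    linear_combination z * e1 + x * e2 - (w (Aᶜ.erase i) k - O k) * h3
  · exfalso
    have hsp : ∀ A : Finset (Fin n), i ∉ A →
        w A - O ∈ Submodule.span ℝ (Set.range ![P - O, Q - O]) := by
      intro A hA
      obtain ⟨x, y, z, t, hx, hy, hz, ht, h1, h2⟩ := key A hA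
      have hd : x * t - y * z ≠ 0 := by
        intro h
        exact hdet ⟨A, hA, x, y, z, t, hx, hy, hz, ht, h1, h2, sub_eq_zero.mp h⟩
      have : w A - O = (t / (x * t - y * z)) • (P - O) + (y / (x * t - y * z)) • (Q - O) := by
        ext k
        have e1 := congrFun h1 k
        have e2 := congrFun h2 k
        simp only [Pi.sub_apply, Pi.add_apply, Pi.smul_apply, Pi.neg_apply, smul_eq_mul] at e1 e2 ⊢
        rw [div_mul_eq_mul_div, div_mul_eq_mul_div, ← add_div, eq_div_iff hd]
        linear_combination -t * e1 - y * e2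
      rw [this]
      exact Submodule.add_mem _ (Submodule.smul_mem _ _ (Submodule.subset_span ⟨0, rfl⟩))
        (Submodule.smul_mem _ _ (Submodule.subset_span ⟨1, rfl⟩))
    have hall : ∀ A : Finset (Fin n),
        w A - O ∈ Submodule.span ℝ (Set.range ![P - O, Q - O]) := by
      intro A
      by_cases hA : i ∈ A
      · obtain ⟨s, hs, h⟩ := opp Aᶜ
        rw [compl_compl] at h
        rw [h]
        exact Submodule.neg_mem _ (Submodule.smul_mem _ _ (hsp _ (by simpa using hA)))
      · exact hsp A hA
    have hle : affineSpan ℝ (Set.range w) ≤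
        AffineSubspace.mk' O (Submodule.span ℝ (Set.range ![P - O, Q - O])) := by
      rw [affineSpan_le]
      rintro _ ⟨D, rfl⟩
      simpa [AffineSubspace.mem_mk'] using hall D
    rw [hw.span_top] at hle
    have h3 := Submodule.finrank_mono (AffineSubspace.direction_le hle)
    rw [AffineSubspace.direction_top, AffineSubspace.direction_mk', finrank_top] at h3
    have h4 := finrank_range_le_card (R := ℝ) ![P - O, Q - O]
    simp [Set.finrank] at h3 h4
    omega

lemma cfc_fun {n : ℕ} {w : Finset (Fin n) → (Fin n → ℝ)} (hw : IsRealizedCube n w)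
    {O : Fin n → ℝ} (hO : ∀ A : Finset (Fin n), O ∈ openSegment ℝ (w A) (w Aᶜ))
    (S : Set (Finset (Fin n))) (hS : IsHypFlat n w S) (A X : Finset (Fin n)) (hA : A ∈ S)
    (hA' : Aᶜ ∈ S) (hX : X ∉ S) :
    ∃ f : (Fin n → ℝ) →ₗ[ℝ] ℝ, (∀ B ∈ S, f (w B - O) = 0) ∧ f (w X - O) ≠ 0 := by
  set M := affineSpan ℝ (w '' S)
  have hm : ∀ B ∈ S, w B ∈ M := fun B hB => mem_affineSpan ℝ ⟨B, hB, rfl⟩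
  have hOM : O ∈ M := M.convex.segment_subset (hm A hA) (hm _ hA')
    (openSegment_subset_segment _ _ _ (hO A))
  have hXM : w X - O ∉ M.direction := by
    intro h
    have h1 : w X ∈ M := by
      have := AffineSubspace.vadd_mem_of_mem_direction h hOM
      simpa using this
    have h2 : w X ∈ w '' S := by
      rw [← hS.2]; exact ⟨⟨X, rfl⟩, h1⟩
    obtain ⟨Y, hY, e⟩ := h2
    exact hX (hw.inj e ▸ hY)
  obtain ⟨f, hf, hle⟩ := Submodule.exists_le_ker_of_notMem hXM
  refine ⟨f, fun B hB => ?_, hf⟩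
  exact hle (AffineSubspace.vsub_mem_direction (hm B hB) hOM)

lemma cfc_alg {a b c d x y : ℝ} (h1 : a * b < 0) (h2 : 0 < c * d) (e1 : x * a + y * b = 0)
    (e2 : x * c + y * d = 0) : x = 0 := by
  have hb : 0 < b ^ 2 := by
    have : b ≠ 0 := by rintro rfl; simp at h1
    positivity
  have hd : 0 < d ^ 2 := by
    have : d ≠ 0 := by rintro rfl; simp at h2
    positivity
  have p1 : x * y * b ^ 2 = x ^ 2 * -(a * b) := by linear_combination x * b * e1
  have p2 : x ^ 2 * (c * d) = -(x * y) * d ^ 2 := by linear_combination x * d * e2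
  have q1 : 0 ≤ x * y := by
    by_contra h
    push Not at h
    nlinarith [mul_pos_of_neg_of_neg h (neg_neg_of_pos hb), mul_nonneg (sq_nonneg x) (neg_nonneg.mpr h1.le)]
  have q2 : x ^ 2 * (c * d) ≤ 0 := by rw [p2]; nlinarith [mul_nonneg q1 hd.le]
  by_contra hx
  have : 0 < x ^ 2 := by positivity
  nlinarith [mul_pos this h2]

lemma cfc_indep {n : ℕ} (hn : 3 ≤ n) {w : Finset (Fin n) → (Fin n → ℝ)} (hw : IsRealizedCube n w)
    {O : Fin n → ℝ} (hO : ∀ A : Finset (Fin n), O ∈ openSegment ℝ (w A) (w Aᶜ))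
    (P Q : Fin n → (Fin n → ℝ))
    (hP : ∀ (i : Fin n) (A : Finset (Fin n)), i ∉ A →
        P i ∈ openSegment ℝ (w A) (w (Aᶜ.erase i)))
    (hmid : ∀ i, O ∈ openSegment ℝ (P i) (Q i)) :
    LinearIndependent ℝ (fun i => P i - Q i) := by
  have hd : ∀ i, ∃ r : ℝ, 0 < r ∧ P i - Q i = r • (P i - O) := by
    intro i
    obtain ⟨a, b, ha, hb, hab, h⟩ := hmid i
    refine ⟨b⁻¹, by positivity, ?_⟩
    ext k
    have := congrFun h k
    simp only [Pi.sub_apply, Pi.add_apply, Pi.smul_apply, smul_eq_mul] at this ⊢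
    field_simp
    linear_combination P i k * hab - this
  -- evaluation of functionals on `P i - Q i`
  have ev : ∀ (f : (Fin n → ℝ) →ₗ[ℝ] ℝ) (i : Fin n) (A : Finset (Fin n)), i ∉ A →
      f (w A - O) = 0 → ∃ r : ℝ, 0 < r ∧ f (P i - Q i) = r * f (w (Aᶜ.erase i) - O) := by
    intro f i A hA hf
    obtain ⟨r, hr, h⟩ := hd i
    obtain ⟨a, b, ha, hb, h'⟩ := cfc_seg O (hP i A hA)
    refine ⟨r * b, by positivity, ?_⟩
    rw [h, h']
    simp [hf]
    ring
  rw [Fintype.linearIndependent_iff]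
  intro g hg i
  obtain ⟨j, hji⟩ : ∃ j : Fin n, j ≠ i := by
    have : Nontrivial (Fin n) := Fin.nontrivial_iff_two_le.mpr (by omega)
    exact exists_ne i
  have two : ∀ f : (Fin n → ℝ) →ₗ[ℝ] ℝ, (∀ k, k ≠ i → k ≠ j → f (P k - Q k) = 0) →
      g i * f (P i - Q i) + g j * f (P j - Q j) = 0 := by
    intro f hf
    have h := congrArg f hg
    rw [map_sum, map_zero] at h
    rw [← h, ← Finset.sum_subset (Finset.subset_univ ({i, j} : Finset (Fin n)))]
    · rw [Finset.sum_pair hji.symm]; simp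
    · intro k _ hk
      simp only [Finset.mem_insert, Finset.mem_singleton, not_or] at hk
      rw [map_smul, hf k hk.1 hk.2, smul_zero]
  obtain ⟨f, hf0, hf1⟩ := cfc_fun hw hO _ (hw.skew_pos i j hji.symm) ∅ (Finset.univ.erase i)
    (by simp) (by simp) (by simp [hji])
  obtain ⟨f', hf'0, hf'1⟩ := cfc_fun hw hO _ (hw.skew_neg i j hji.symm) {i}
    ((Finset.univ.erase i).erase j) (by simp [hji]) (by simp [hji]) (by simp)
  have e1 := two f (by
    intro k hki hkj
    obtain ⟨r, hr, h⟩ := ev f k ∅ (by simp) (hf0 _ (by simp))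
    rw [h, hf0 _ (by simp [hki.symm, hkj.symm]), mul_zero])
  have e2 := two f' (by
    intro k hki hkj
    obtain ⟨r, hr, h⟩ := ev f' k {i} (by simp [hki]) (hf'0 _ (by simp [hji]))
    rw [h, hf'0 _ (by simp [hki.symm, hkj.symm, hji]), mul_zero])
  refine cfc_alg ?_ ?_ e1 e2
  · obtain ⟨r, hr, h⟩ := ev f i ∅ (by simp) (hf0 _ (by simp))
    obtain ⟨s, hs, h'⟩ := ev f j ∅ (by simp) (hf0 _ (by simp))
    rw [h, h', Finset.compl_empty]
    obtain ⟨Z, hZ1, hZ2⟩ := hw.rect Finset.univ {i} {j} (by simpa using hji.symm) (by simp) (by simp)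
    have c1 : (Finset.univ : Finset (Fin n)) ∆ {i} = Finset.univ.erase i := by
      ext k; simp [Finset.mem_symmDiff]
    have c2 : (Finset.univ : Finset (Fin n)) ∆ {j} = Finset.univ.erase j := by
      ext k; simp [Finset.mem_symmDiff]
    rw [c1, c2] at hZ2
    obtain ⟨a, b, ha, hb, h1⟩ := cfc_seg O hZ1
    obtain ⟨c, d, hc, hd', h2⟩ := cfc_seg O hZ2
    have z1 : f (Z - O) = 0 := by
      rw [h1, map_add, map_smul, map_smul, hf0 _ (by simp), hf0 _ (by simp [Finset.mem_symmDiff])]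
      simp
    rw [h2, map_add, map_smul, map_smul, smul_eq_mul, smul_eq_mul] at z1
    set u := f (w (Finset.univ.erase i) - O)
    set v := f (w (Finset.univ.erase j) - O)
    have hv : v = -(c / d) * u := by field_simp; linear_combination z1
    have : r * u * (s * v) = -(r * s * (c / d) * u ^ 2) := by rw [hv]; ring
    rw [this]
    have : 0 < r * s * (c / d) * u ^ 2 := by positivity
    linarith
  · obtain ⟨r, hr, h⟩ := ev f' i {j} (by simp [hji.symm]) (hf'0 _ (by simp [hji.symm]))
    obtain ⟨s, hs, h'⟩ := ev f' j {i} (by simp [hji]) (hf'0 _ (by simp [hji]))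
    have c1 : ({j} : Finset (Fin n))ᶜ.erase i = (Finset.univ.erase i).erase j := by
      ext k; simp; tauto
    have c2 : ({i} : Finset (Fin n))ᶜ.erase j = (Finset.univ.erase i).erase j := by
      ext k; simp
    rw [h, h', c1, c2]
    set u := f' (w ((Finset.univ.erase i).erase j) - O)
    have : r * u * (s * u) = r * s * u ^ 2 := by ring
    rw [this]
    positivity

lemma cfc_facet {n : ℕ} (hn : 3 ≤ n) {w : Finset (Fin n) → (Fin n → ℝ)} (hw : IsRealizedCube n w)
    (i : Fin n) (S : Set (Finset (Fin n))) (hS : S = {A | i ∉ A} ∨ S = {A | i ∈ A})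
    (hflat : IsHypFlat n w S) :
    ∃! P : Fin n → ℝ, ∀ C ∈ S, P ∈ openSegment ℝ (w C) (w (C ∆ (Finset.univ.erase i))) := by
  have : Nontrivial (Fin n) := Fin.nontrivial_iff_two_le.mpr (by omega)
  obtain ⟨j, hji⟩ := exists_ne i
  obtain ⟨k, hki, hkj⟩ : ∃ k : Fin n, k ≠ i ∧ k ≠ j := by
    have : ∃ k, k ∉ ({i, j} : Finset (Fin n)) := by
      by_contra h
      push Not at h
      have h1 := Finset.card_le_card (fun x _ => h x : Finset.univ ⊆ ({i, j} : Finset (Fin n)))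
      have h2 : Finset.card ({i, j} : Finset (Fin n)) ≤ 2 := Finset.card_le_two
      simp at h1
      omega
    obtain ⟨k, hk⟩ := this
    simp at hk
    exact ⟨k, hk.1, hk.2⟩
  obtain ⟨A, hA⟩ : ∃ A, A ∈ S := by
    rcases hS with rfl | rfl
    · exact ⟨∅, by simp⟩
    · exact ⟨{i}, by simp⟩
  have hS' : ∀ C D : Finset (Fin n), C ∈ S → (D ∈ S ↔ i ∉ C ∆ D) := by
    rcases hS with rfl | rfl <;> intro C D hC <;> simp [Finset.mem_symmDiff] at hC ⊢ <;> tauto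
  refine cfc_conc hw S (Finset.univ.erase i) ⟨j, by simp [hji]⟩ ?_ ?_ A (A ∆ {j}) hA ?_ ?_ ?_ ?_
  · intro C hC
    rw [hS' C _ hC]; simp
  · intro C hC D hD x hx
    simp only [Finset.mem_erase, Finset.mem_univ, and_true]
    rintro rfl
    exact (hS' C D hC).mp hD hx
  · rw [hS' A _ hA]; simp [hji.symm]
  · intro h
    have := symmDiff_eq_left.mp h
    simp at this
  · intro h
    have h1 := symmDiff_right_injective A h
    have : k ∈ ({j} : Finset (Fin n)) := by rw [h1]; simp [hki]
    simp [hkj] at this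
  · intro C hC h1 h2 h3 h4
    rw [hflat.1]
    by_contra hlt
    have hn3 : n = 3 := by omega
    have huniv : ∀ x : Fin n, x = i ∨ x = j ∨ x = k := by
      intro x
      by_contra hx
      push Not at hx
      have : Finset.card ({x, i, j, k} : Finset (Fin n)) = 4 := by
        rw [Finset.card_insert_of_notMem (by simp [hx]), Finset.card_insert_of_notMem (by simp [hji.symm, hki.symm]),
          Finset.card_insert_of_notMem (by simp [hkj.symm])]
        simp
      have h5 := Finset.card_le_univ ({x, i, j, k} : Finset (Fin n))
      simp at h5
      omega
    have hi := (hS' A C hA).mp hC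
    have hE : ∀ E : Finset (Fin n), (j ∈ A ∆ C ↔ j ∈ E) → (k ∈ A ∆ C ↔ k ∈ E) → i ∉ E → C = A ∆ E := by
      intro E e1 e2 e3
      have : A ∆ C = E := by
        ext x
        rcases huniv x with rfl | rfl | rfl <;> tauto
      rw [← this, symmDiff_symmDiff_cancel_left]
    by_cases hj : j ∈ A ∆ C <;> by_cases hk : k ∈ A ∆ C
    · exact h2 (hE _ (by simp [hj, hji]) (by simp [hk, hki]) (by simp))
    · exact h3 (hE _ (by simp [hj]) (by simp [hk, hkj]) (by simp [hji.symm]))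
    · apply h4
      rw [symmDiff_assoc]
      exact hE _ (by simp [hj, hji, Finset.mem_symmDiff]) (by simp [hk, hki, hkj, Finset.mem_symmDiff])
        (by simp [hji.symm, Finset.mem_symmDiff])
    · apply h1
      have := hE ∅ (by simp [hj]) (by simp [hk]) (by simp)
      rw [this]
      exact symmDiff_bot A

/-- For a realized oriented cube with `n ≥ 3` and center `O`:
(a) each facet in direction `i` has a unique center (the common point of its diagonals);
(b) `O` lies on the open segment joining the two facet centers in each direction `i`;
(c) the differences of opposite facet centers are linearly independent, so the `2n`
facet centers realize the `n`-dimensional cross-polytope. -/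
theorem cube_facet_centers (n : ℕ) (hn : 3 ≤ n) (w : Finset (Fin n) → (Fin n → ℝ))
    (hw : IsRealizedCube n w) (O : Fin n → ℝ)
    (hO : ∀ A : Finset (Fin n), O ∈ openSegment ℝ (w A) (w Aᶜ)) :
    (∀ i : Fin n,
      (∃! P : Fin n → ℝ, ∀ A : Finset (Fin n), i ∉ A →
        P ∈ openSegment ℝ (w A) (w (Aᶜ.erase i))) ∧
      (∃! Q : Fin n → ℝ, ∀ A : Finset (Fin n), i ∈ A →
        Q ∈ openSegment ℝ (w A) (w (insert i Aᶜ)))) ∧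
    (∀ (i : Fin n) (P Q : Fin n → ℝ),
      (∀ A : Finset (Fin n), i ∉ A → P ∈ openSegment ℝ (w A) (w (Aᶜ.erase i))) →
      (∀ A : Finset (Fin n), i ∈ A → Q ∈ openSegment ℝ (w A) (w (insert i Aᶜ))) →
      O ∈ openSegment ℝ P Q) ∧
    (∀ P Q : Fin n → (Fin n → ℝ),
      (∀ (i : Fin n) (A : Finset (Fin n)), i ∉ A →
        P i ∈ openSegment ℝ (w A) (w (Aᶜ.erase i))) →
      (∀ (i : Fin n) (A : Finset (Fin n)), i ∈ A →
        Q i ∈ openSegment ℝ (w A) (w (insert i Aᶜ))) →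
      LinearIndependent ℝ (fun i => P i - Q i)) := by
  have mid := cfc_mid hn hw hO
  refine ⟨fun i => ⟨?_, ?_⟩, mid, ?_⟩
  · have h := cfc_facet hn hw i _ (Or.inl rfl) (hw.facet_pos i)
    have e : ∀ A : Finset (Fin n), i ∉ A → Aᶜ.erase i = A ∆ (Finset.univ.erase i) := by
      intro A hA
      ext x
      by_cases hx : x = i
      · subst hx; simp [Finset.mem_symmDiff, hA]
      · simp [Finset.mem_symmDiff, hx]
    obtain ⟨P, hP, hu⟩ := h
    refine ⟨P, fun A hA => ?_, fun Y hY => hu Y fun A hA => ?_⟩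
    · rw [e A hA]; exact hP A hA
    · rw [← e A hA]; exact hY A hA
  · have h := cfc_facet hn hw i _ (Or.inr rfl) (hw.facet_neg i)
    have e : ∀ A : Finset (Fin n), i ∈ A → insert i Aᶜ = A ∆ (Finset.univ.erase i) := by
      intro A hA
      ext x
      by_cases hx : x = i
      · subst hx; simp [Finset.mem_symmDiff, hA]
      · simp [Finset.mem_symmDiff, hx]
    obtain ⟨P, hP, hu⟩ := h
    refine ⟨P, fun A hA => ?_, fun Y hY => hu Y fun A hA => ?_⟩
    · rw [e A hA]; exact hP A hA
    · rw [← e A hA]; exact hY A hA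
  · intro P Q hP hQ
    exact cfc_indep hn hw hO P Q hP fun i => mid i (P i) (Q i) (hP i) (hQ i)
end

section
/- Let n ≥ 2, let y : Fin n → ℝⁿ and b ∈ ℝⁿ be such that the n+1 points y 0, …, y (n−1), b form an affine basis of ℝⁿ, and let x : Finset (Fin n) → ℝⁿ satisfy: (a) x Finset.univ = b; (b) for every A : Finset (Fin n) and every i ∉ A, the point x A lies on the open segment joining y i and x (insert i A); (c) for every i : Fin n, every point x A with i ∈ A lies in the affine span of {y j : j ≠ i} ∪ {b}; (d) for every i : Fin n, there is an affine hyperplane of ℝⁿ containing all points x A with i ∉ A and all points y j with j ≠ i; (e) no point x A lies in the affine span of {y j : j : Fin n}. Then c := x ∅ lies in the interior of the convex hull of {y j : j : Fin n} ∪ {b}, and for every A : Finset (Fin n), x A is the unique point in the intersection of the affine span of {y i : i ∈ A} ∪ {c} with the convex hull of {y i : i ∉ A} ∪ {b}; in particular the family x is uniquely determined by the affine basis (y, b) and the point x ∅. -/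
theorem aff_zero {n : ℕ} (f : (Fin n → ℝ) →ᵃ[ℝ] ℝ) (s : Set (Fin n → ℝ))
    (h : ∀ p ∈ s, f p = 0) (p : Fin n → ℝ) (hp : p ∈ affineSpan ℝ s) : f p = 0 := by
  refine affineSpan_induction (p := fun q => f q = 0) hp h ?_
  intro c u v w hu hv hw
  rw [AffineMap.map_vadd, map_smul, AffineMap.linearMap_vsub, hu, hv, hw]
  simp

theorem down_ind {n : ℕ} (P : Finset (Fin n) → Prop) (h0 : P Finset.univ)
    (h : ∀ A i, i ∉ A → P (insert i A) → P A) (A : Finset (Fin n)) : P A := by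
  have key : ∀ C : Finset (Fin n), P Cᶜ := by
    intro C
    induction C using Finset.induction_on with
    | empty => simpa using h0
    | insert i C hi ih =>
      apply h _ i (by simp)
      have : insert i (insert i C)ᶜ = Cᶜ := by
        ext j; by_cases hj : j = i <;> simp [hj, hi]
      rwa [this]
  simpa using key Aᶜ

/-- Realized form of the uniqueness of the realizable adjoint of the cross-polytope:
given an affine basis `(y, b)` of `ℝⁿ` (`n ≥ 2`) and a family `x` indexed by finsets
satisfying the adjoint circuit and hyperplane conditions, the point `c = x ∅` is interior
to the simplex and each `x A` is the unique point where the affine span of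
`{y i : i ∈ A} ∪ {c}` meets the face `conv ({y i : i ∉ A} ∪ {b})`; in particular `x` is
determined by the basis and `x ∅`. -/
theorem adjoint_realization_unique (n : ℕ) (hn : 2 ≤ n)
    (y : Fin n → (Fin n → ℝ)) (b : Fin n → ℝ)
    (hindep : AffineIndependent ℝ (fun o : Option (Fin n) => o.elim b y))
    (hspan : affineSpan ℝ (Set.range (fun o : Option (Fin n) => o.elim b y)) = ⊤)
    (x : Finset (Fin n) → (Fin n → ℝ))
    (ha : x Finset.univ = b)
    (hb : ∀ (A : Finset (Fin n)) (i : Fin n), i ∉ A →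
      x A ∈ openSegment ℝ (y i) (x (insert i A)))
    (hc : ∀ (i : Fin n) (A : Finset (Fin n)), i ∈ A →
      x A ∈ affineSpan ℝ ({p | ∃ j : Fin n, j ≠ i ∧ p = y j} ∪ {b}))
    (hd : ∀ i : Fin n, ∃ H : AffineSubspace ℝ (Fin n → ℝ),
      Module.finrank ℝ H.direction = n - 1 ∧
      (∀ A : Finset (Fin n), i ∉ A → x A ∈ H) ∧ (∀ j : Fin n, j ≠ i → y j ∈ H))
    (he : ∀ A : Finset (Fin n), x A ∉ affineSpan ℝ (Set.range y)) :
    x ∅ ∈ interior (convexHull ℝ (Set.range y ∪ {b})) ∧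
    ∀ A : Finset (Fin n),
      (affineSpan ℝ ((y '' ↑A) ∪ {x ∅}) : Set (Fin n → ℝ)) ∩
        convexHull ℝ ((y '' {i | i ∉ A}) ∪ {b}) = {x A} := by
  classical
  let B : AffineBasis (Option (Fin n)) ℝ (Fin n → ℝ) := ⟨_, hindep, hspan⟩
  have hBs : ∀ i, y i = B (some i) := fun i => rfl
  have hBn : b = B none := rfl
  have hrange : Set.range y ∪ {b} = Set.range B := by
    ext p
    constructor
    · rintro (⟨i, rfl⟩ | rfl)
      · exact ⟨some i, rfl⟩
      · exact ⟨none, rfl⟩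
    · rintro ⟨_ | i, rfl⟩
      · right; rfl
      · left; exact ⟨i, rfl⟩
  -- coordinates
  have hy : ∀ i o, B.coord o (y i) = if o = some i then 1 else 0 := by
    intro i o; rw [hBs, B.coord_apply]
  have hbc : ∀ o, B.coord o b = if o = none then 1 else 0 := by
    intro o; rw [hBn, B.coord_apply]
  have hzero : ∀ i A, i ∈ A → B.coord (some i) (x A) = 0 := by
    intro i A hi
    apply aff_zero _ _ _ _ (hc i A hi)
    rintro p (⟨j, hj, rfl⟩ | rfl)
    · rw [hy]; simp [hj.symm]
    · rw [hbc]; simp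
  have hb' : ∀ A i, i ∉ A → ∃ s t : ℝ, 0 < s ∧ 0 < t ∧ s + t = 1 ∧
      x A = AffineMap.lineMap (y i) (x (insert i A)) t := by
    intro A i hi
    obtain ⟨s, t, hs, ht, hst, h⟩ := hb A i hi
    refine ⟨s, t, hs, ht, hst, ?_⟩
    rw [AffineMap.lineMap_apply_module, ← h, ← hst]; simp
  have hco : ∀ A i, i ∉ A → ∃ s t : ℝ, 0 < s ∧ 0 < t ∧ s + t = 1 ∧
      ∀ o, B.coord o (x A) = s * B.coord o (y i) + t * B.coord o (x (insert i A)) := by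
    intro A i hi
    obtain ⟨s, t, hs, ht, hst, h⟩ := hb' A i hi
    refine ⟨s, t, hs, ht, hst, fun o => ?_⟩
    rw [h, AffineMap.apply_lineMap, AffineMap.lineMap_apply_module, ← hst]; simp
  have hposn : ∀ A, 0 < B.coord none (x A) := by
    apply down_ind
    · rw [ha, hbc]; simp
    · intro A i hi ih
      obtain ⟨s, t, hs, ht, hst, h⟩ := hco A i hi
      rw [h, hy]; simp; positivity
  have hpos : ∀ A i, i ∉ A → 0 < B.coord (some i) (x A) := by
    intro A i hi
    obtain ⟨s, t, hs, ht, hst, h⟩ := hco A i hi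
    rw [h, hy, hzero i _ (Finset.mem_insert_self _ _)]; simpa
  have hconv : ∀ A, x A ∈ convexHull ℝ ((y '' {i | i ∉ A}) ∪ {b}) := by
    apply down_ind
    · rw [ha]; exact subset_convexHull _ _ (by simp)
    · intro A i hi ih
      apply (convex_convexHull ℝ _).openSegment_subset _ _ (hb A i hi)
      · exact subset_convexHull _ _ (Or.inl ⟨i, hi, rfl⟩)
      · refine convexHull_mono ?_ ih
        apply Set.union_subset_union_left
        apply Set.image_mono
        intro j hj hj'
        exact hj (Finset.mem_insert_of_mem hj')
  have haff : ∀ A : Finset (Fin n), x A ∈ affineSpan ℝ ((y '' ↑A) ∪ {x ∅}) := by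
    intro A
    induction A using Finset.induction_on with
    | empty => exact subset_affineSpan _ _ (by simp)
    | insert i A hi ih =>
      obtain ⟨s, t, hs, ht, hst, h⟩ := hb' A i hi
      have h2 : x (insert i A) = AffineMap.lineMap (y i) (x A) t⁻¹ := by
        rw [h]
        simp [AffineMap.lineMap_apply, smul_smul, ht.ne']
      rw [h2]
      apply AffineMap.lineMap_mem
      · exact subset_affineSpan _ _ (Or.inl ⟨i, by simp, rfl⟩)
      · refine affineSpan_mono ℝ ?_ ih
        apply Set.union_subset_union_left
        apply Set.image_mono
        intro j hj
        simp at hj ⊢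
        exact Or.inr hj
  refine ⟨?_, ?_⟩
  · rw [hrange, B.interior_convexHull]
    rintro (_ | i)
    · exact hposn _
    · exact hpos _ _ (by simp)
  · intro A
    have hprop : ∀ p ∈ affineSpan ℝ ((y '' ↑A) ∪ {x ∅}), ∀ j ∉ A,
        B.coord (some j) p * B.coord none (x ∅) = B.coord none p * B.coord (some j) (x ∅) := by
      intro p hp j hj
      have := aff_zero (B.coord none (x ∅) • B.coord (some j) - B.coord (some j) (x ∅) • B.coord none)
        _ ?_ p hp
      · simp at this
        linarith
      · rintro q (⟨i, hi, rfl⟩ | rfl)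
        · have : j ≠ i := by rintro rfl; exact hj hi
          simp [hy, this]
        · simp; ring
    apply Set.eq_singleton_iff_unique_mem.2
    refine ⟨⟨haff A, hconv A⟩, ?_⟩
    rintro p ⟨hp1, hp2⟩
    have hpz : ∀ i ∈ A, B.coord (some i) p = 0 := by
      intro i hi
      apply aff_zero _ _ _ _ (convexHull_subset_affineSpan _ hp2)
      rintro q (⟨j, hj, rfl⟩ | rfl)
      · have : i ≠ j := by rintro rfl; exact hj hi
        rw [hy]; simp [this]
      · rw [hbc]; simp
    have hall : ∀ o, B.coord o p * B.coord none (x A) = B.coord none p * B.coord o (x A) := by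
      rintro (_ | i)
      · rfl
      · by_cases hi : i ∈ A
        · rw [hpz i hi, hzero i A hi]; simp
        · have e1 := hprop p hp1 i hi
          have e2 := hprop _ (haff A) i hi
          apply mul_right_cancel₀ (hposn ∅).ne'
          linear_combination B.coord none (x A) * e1 - B.coord none p * e2
    have hsum : B.coord none (x A) = B.coord none p := by
      have := Finset.sum_congr (rfl : (Finset.univ : Finset (Option (Fin n))) = _) (fun o _ => hall o)
      rwa [← Finset.sum_mul, ← Finset.mul_sum, B.sum_coord_apply_eq_one,
        B.sum_coord_apply_eq_one, one_mul, mul_one] at this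
    apply B.ext_elem
    intro o
    have := hall o
    rw [← hsum, mul_comm] at this
    exact mul_left_cancel₀ (hposn A).ne' this
end

section
/- Let n ≥ 1, let y : Fin n → ℝⁿ and b ∈ ℝⁿ be such that the n+1 points y 0, …, y (n−1), b form an affine basis of ℝⁿ, and let c be a point in the interior of the convex hull of {y i : i : Fin n} ∪ {b}. Then for every A : Finset (Fin n), the intersection of the affine span of {y i : i ∈ A} ∪ {c} with the convex hull of {y i : i ∉ A} ∪ {b} consists of exactly one point. -/
/-- Given an affine basis `(y, b)` of `ℝⁿ` (`n ≥ 1`) and a point `c` interior to the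
simplex `conv ({y i} ∪ {b})`, for every `A ⊆ Fin n` the affine span of
`{y i : i ∈ A} ∪ {c}` meets the face `conv ({y i : i ∉ A} ∪ {b})` in exactly one point. -/
theorem span_meets_face_uniquely (n : ℕ) (hn : 1 ≤ n)
    (y : Fin n → (Fin n → ℝ)) (b : Fin n → ℝ)
    (hindep : AffineIndependent ℝ (fun o : Option (Fin n) => o.elim b y))
    (hspan : affineSpan ℝ (Set.range (fun o : Option (Fin n) => o.elim b y)) = ⊤)
    (c : Fin n → ℝ) (hc : c ∈ interior (convexHull ℝ (Set.range y ∪ {b}))) :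
    ∀ A : Finset (Fin n),
      ∃! p : Fin n → ℝ,
        p ∈ (affineSpan ℝ ((y '' ↑A) ∪ {c}) : Set (Fin n → ℝ)) ∩
          convexHull ℝ ((y '' {i | i ∉ A}) ∪ {b}) := by
  classical
  intro A
  let B : AffineBasis (Option (Fin n)) ℝ (Fin n → ℝ) := ⟨_, hindep, hspan⟩
  have hBs : ∀ i, B (some i) = y i := fun i => rfl
  have hBn : B none = b := rfl
  have hr : Set.range y ∪ {b} = Set.range B := by
    ext x
    simp only [Set.mem_union, Set.mem_range, Set.mem_singleton_iff, Option.exists, hBs, hBn]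
    constructor
    · rintro (h | h)
      · exact Or.inr h
      · exact Or.inl h.symm
    · rintro (h | h)
      · exact Or.inr h.symm
      · exact Or.inl h
  rw [hr, B.interior_convexHull] at hc
  have hpos : ∀ o, 0 < B.coord o c := hc
  let m : Option (Fin n) → ℝ := fun o => o.elim (B.coord none c) (fun i => if i ∈ A then 0 else B.coord (some i) c)
  have hm0 : ∀ o, 0 ≤ m o := by
    rintro (_ | i)
    · exact (hpos none).le
    · change 0 ≤ if i ∈ A then 0 else B.coord (some i) c
      split_ifs
      · exact le_rfl
      · exact (hpos _).le
  let S := ∑ o, m o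
  have hS : 0 < S := lt_of_lt_of_le (hpos none)
    (Finset.single_le_sum (f := m) (fun o _ => hm0 o) (Finset.mem_univ none))
  have hmA : ∀ i ∈ A, m (some i) = 0 := fun i hi => if_pos hi
  have hmnA : ∀ i, i ∉ A → m (some i) = B.coord (some i) c := fun i hi => if_neg hi
  have hmn : m none = B.coord none c := rfl
  have hw1 : ∑ o, m o / S = 1 := by
    rw [← Finset.sum_div]; exact div_self hS.ne'
  refine ⟨∑ o, (m o / S) • B o, ⟨?_, ?_⟩, ?_⟩
  · have hcs : c ∈ affineSpan ℝ ((y '' ↑A) ∪ {c}) := subset_affineSpan _ _ (by simp)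
    have hd : ∑ i ∈ A, (B.coord (some i) c / S) • (c -ᵥ y i) ∈
        (affineSpan ℝ ((y '' ↑A) ∪ {c})).direction := by
      refine Submodule.sum_mem _ fun i hi => Submodule.smul_mem _ _ ?_
      exact AffineSubspace.vsub_mem_direction hcs
        (subset_affineSpan _ _ (Or.inl ⟨i, hi, rfl⟩))
    have := AffineSubspace.vadd_mem_of_mem_direction hd hcs
    rw [SetLike.mem_coe]
    refine (congrArg (· ∈ affineSpan ℝ ((y '' ↑A) ∪ {c})) ?_).mpr this
    have key : ∀ (F : Type) [AddCommGroup F] [Module ℝ F] (z : Option (Fin n) → F),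
        ∑ o, B.coord o c • z o = ∑ o, m o • z o + ∑ i ∈ A, B.coord (some i) c • z (some i) := by
      intro F _ _ z
      rw [Fintype.sum_option, Fintype.sum_option, ← Finset.sum_filter_add_sum_filter_not Finset.univ (· ∈ A),
        add_assoc, hmn, add_right_inj, add_comm]
      congr 1
      · rw [Finset.sum_filter]
        refine Finset.sum_congr rfl fun i _ => ?_
        by_cases hi : i ∈ A
        · simp [hi, hmA]
        · simp [hi, hmnA]
      · simp
    have k1 := key ℝ (fun _ => 1)
    have k2 := key _ B
    rw [B.linear_combination_coord_eq_self] at k2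
    simp only [smul_eq_mul, mul_one, B.sum_coord_apply_eq_one] at k1
    have e1 : ∑ i ∈ A, B.coord (some i) c = 1 - S := by
      change 1 = S + _ at k1
      linarith
    have e2 : ∑ o, m o • B o = c - ∑ i ∈ A, B.coord (some i) c • y i := by
      rw [eq_sub_iff_add_eq]; exact k2.symm
    simp only [div_eq_inv_mul, mul_smul, ← Finset.smul_sum, vsub_eq_sub, vadd_eq_add, smul_sub,
      Finset.sum_sub_distrib, ← Finset.sum_smul, e1, e2]
    rw [sub_smul, smul_sub, inv_smul_smul₀ hS.ne', one_smul]
    abel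
  · have : ∑ o, (m o / S) • B o =
        ∑ o, (m o / S) • (o.elim b (fun i => if i ∈ A then b else y i) : Fin n → ℝ) := by
      refine Finset.sum_congr rfl ?_
      rintro (_ | i) _
      · rfl
      · by_cases hi : i ∈ A
        · simp [hmA i hi]
        · simp [hi, hBs]
    rw [this]
    refine (convex_convexHull ℝ _).sum_mem (fun o _ => div_nonneg (hm0 o) hS.le) hw1 ?_
    rintro (_ | i) _
    · exact subset_convexHull _ _ (by simp)
    · apply subset_convexHull
      by_cases hi : i ∈ A
      · simp [hi]
      · simp only [Option.elim, hi, if_false]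
        exact Or.inl ⟨i, hi, rfl⟩
  · rintro q ⟨hq1, hq2⟩
    have hz : ∀ i ∈ A, B.coord (some i) q = 0 := by
      intro i hi
      have hconv : Convex ℝ ((B.coord (some i)) ⁻¹' {0}) := (convex_singleton 0).affine_preimage _
      refine convexHull_min ?_ hconv hq2
      rintro x (⟨j, hj, rfl⟩ | rfl)
      · exact B.coord_apply_ne (i := some i) (j := some j) (by rintro ⟨⟩; exact hj hi)
      · exact B.coord_apply_ne (i := some i) (j := none) (by simp)
    have hrel : ∀ o, (∀ i ∈ A, o ≠ some i) →
        B.coord o q * B.coord none c = B.coord none q * B.coord o c := by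
      intro o ho
      refine affineSpan_induction (p := fun q => B.coord o q * B.coord none c = B.coord none q * B.coord o c) hq1 ?_ ?_
      · rintro x (⟨j, hj, rfl⟩ | rfl)
        · rw [← hBs, B.coord_apply_ne (ho j hj), B.coord_apply_ne (by simp)]; simp
        · exact mul_comm _ _
      · intro t u v w hu hv hw
        have e : ∀ o, B.coord o (t • (u -ᵥ v) +ᵥ w) =
            t * (B.coord o u - B.coord o v) + B.coord o w := by
          intro o
          rw [AffineMap.map_vadd, map_smul, AffineMap.linearMap_vsub]
          rfl
        rw [e, e]
        linear_combination t * hu - t * hv + hw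
    have hrel' : ∀ o, B.coord o q * B.coord none c = B.coord none q * m o := by
      rintro (_ | i)
      · rfl
      · by_cases hi : i ∈ A
        · simp [hz i hi, hmA i hi]
        · rw [hmnA i hi]
          exact hrel _ (by rintro j hj ⟨⟩; exact hi hj)
    have hsum : B.coord none c = B.coord none q * S := by
      have := Finset.sum_congr (rfl : (Finset.univ : Finset (Option (Fin n))) = _) fun o _ => hrel' o
      rwa [← Finset.sum_mul, ← Finset.mul_sum, B.sum_coord_apply_eq_one, one_mul] at this
    rw [← B.linear_combination_coord_eq_self q]
    refine Finset.sum_congr rfl fun o _ => ?_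
    congr 1
    rw [eq_div_iff hS.ne']
    apply mul_right_cancel₀ (hpos none).ne'
    linear_combination S * hrel' o - m o * hsum
end

section
/- Let n ≥ 1 and work in ℝⁿ × ℝ. Let H be the affine hyperplane {(x, t) : x_1 + ⋯ + x_n + (n+2)·t = 2}, let y_i := (2·e_i, 0) for i : Fin n and b := (v_univ, 1), where v_univ = (−1, …, −1). Then for every A : Finset (Fin n) and every real λ > 0, one has λ • (v_A, 1) ∈ H if and only if λ = 1/(n + 1 − A.card); moreover the intersection point satisfies (1/(n + 1 − A.card)) • (v_A, 1) = (1/(n + 1 − A.card)) • (b + ∑_{i ∉ A} y_i), i.e., it is the barycenter of the n + 1 − |A| points b and y_i (i ∉ A). Also, for every i : Fin n and λ > 0, λ • (e_i, 0) ∈ H if and only if λ = 2. -/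
/-- The vertex `v_A` of the cube: coordinate `-1` on `A`, `1` off `A`. -/
noncomputable def vVec (n : ℕ) (A : Finset (Fin n)) : Fin n → ℝ :=
  fun i => if i ∈ A then -1 else 1

/-- The point `y_i = (2 e_i, 0)` of `ℝⁿ × ℝ`. -/
noncomputable def yPt (n : ℕ) (i : Fin n) : (Fin n → ℝ) × ℝ :=
  (Pi.single i (2 : ℝ), 0)

/-- The point `b = ((−1,…,−1), 1)` of `ℝⁿ × ℝ`. -/
noncomputable def bPt (n : ℕ) : (Fin n → ℝ) × ℝ :=
  (fun _ => -1, 1)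

/-- The affine hyperplane `x₁ + ⋯ + xₙ + (n+2) t = 2` of `ℝⁿ × ℝ`. -/
def Hplane (n : ℕ) : Set ((Fin n → ℝ) × ℝ) :=
  {p | (∑ i, p.1 i) + ((n : ℝ) + 2) * p.2 = 2}

/-- The positive ray through `(v_A, 1)` meets the hyperplane `H` precisely at the
parameter `λ = 1/(n + 1 − |A|)`, and the intersection point is the barycenter of
the `n + 1 − |A|` points `b` and `y_i` (`i ∉ A`); the positive ray through
`(e_i, 0)` meets `H` precisely at `λ = 2`. -/
theorem ray_meets_hyperplane (n : ℕ) (hn : 1 ≤ n) :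
    (∀ (A : Finset (Fin n)) (l : ℝ), 0 < l →
      (l • ((vVec n A, 1) : (Fin n → ℝ) × ℝ) ∈ Hplane n ↔
        l = 1 / ((n : ℝ) + 1 - A.card))) ∧
    (∀ A : Finset (Fin n),
      (1 / ((n : ℝ) + 1 - A.card)) • ((vVec n A, 1) : (Fin n → ℝ) × ℝ) =
        (1 / ((n : ℝ) + 1 - A.card)) • (bPt n + ∑ i ∈ Aᶜ, yPt n i)) ∧
    (∀ (i : Fin n) (l : ℝ), 0 < l →
      (l • ((Pi.single i (1 : ℝ), (0 : ℝ)) : (Fin n → ℝ) × ℝ) ∈ Hplane n ↔ l = 2)) := by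
  have hsum : ∀ A : Finset (Fin n), ∑ i, vVec n A i = (n : ℝ) - 2 * A.card := by
    intro A
    have h : ∀ i, vVec n A i = 1 - 2 * (if i ∈ A then (1 : ℝ) else 0) := by
      intro i
      unfold vVec
      split_ifs <;> norm_num
    simp only [h, Finset.sum_sub_distrib, ← Finset.mul_sum]
    simp
  refine ⟨?_, ?_, ?_⟩
  · intro A l hl
    have hc : (A.card : ℝ) ≤ n := by
      have := Finset.card_le_univ A
      rw [Fintype.card_fin] at this
      exact_mod_cast this
    have hpos : (0 : ℝ) < (n : ℝ) + 1 - A.card := by linarith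
    have h1 : l • ((vVec n A, 1) : (Fin n → ℝ) × ℝ) ∈ Hplane n ↔
        (∑ i, l * vVec n A i) + ((n : ℝ) + 2) * (l * 1) = 2 := Iff.rfl
    rw [h1, ← Finset.mul_sum, hsum, eq_div_iff hpos.ne']
    constructor <;> intro h <;> linarith
  · intro A
    congr 1
    refine Prod.ext ?_ ?_
    · funext j
      by_cases hj : j ∈ A <;>
        simp [vVec, bPt, yPt, Prod.fst_sum, Finset.sum_apply, Pi.single_apply, hj] <;> norm_num
    · simp [bPt, yPt, Prod.snd_sum]
  · intro i l hl
    have h1 : l • ((Pi.single i (1 : ℝ), (0 : ℝ)) : (Fin n → ℝ) × ℝ) ∈ Hplane n ↔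
        (∑ j, l * (Pi.single i (1 : ℝ) : Fin n → ℝ) j) + ((n : ℝ) + 2) * (l * 0) = 2 := Iff.rfl
    rw [h1, ← Finset.mul_sum]
    simp
end

section
/- Let n ≥ 1 and work in ℝⁿ × ℝ. The n + 1 points y_i := (2·e_i, 0) for i : Fin n together with b := (v_univ, 1) = ((−1, …, −1), 1) are affinely independent, and their affine span is exactly the affine hyperplane H = {(x, t) : x_1 + ⋯ + x_n + (n+2)·t = 2}. -/
/-- The `n + 1` points `y_i = (2 e_i, 0)` and `b = ((−1,…,−1), 1)` are affinely
independent and their affine span is exactly the hyperplane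
`x₁ + ⋯ + xₙ + (n+2) t = 2`. -/
theorem basis_of_hyperplane (n : ℕ) (hn : 1 ≤ n) :
    AffineIndependent ℝ (fun o : Option (Fin n) => o.elim (bPt n) (yPt n)) ∧
    (affineSpan ℝ (Set.range (fun o : Option (Fin n) => o.elim (bPt n) (yPt n))) :
      Set ((Fin n → ℝ) × ℝ)) = Hplane n := by
  have key : ∀ w : Option (Fin n) → ℝ,
      ∑ o, w o • (o.elim (bPt n) (yPt n) : (Fin n → ℝ) × ℝ)
        = (fun i => 2 * w (some i) - w none, w none) := by
    intro w
    rw [Fintype.sum_option]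
    ext j
    · simp [bPt, yPt, Prod.fst_sum, Finset.sum_apply, Pi.single_apply]
      ring
    · simp [bPt, yPt, Prod.snd_sum]
  refine ⟨?_, ?_⟩
  · rw [affineIndependent_iff_of_fintype]
    intro w hw h
    rw [Finset.weightedVSub_eq_linear_combination _ hw, key w] at h
    have h2 : w none = 0 := congrArg Prod.snd h
    intro o
    cases o with
    | none => exact h2
    | some i =>
      have h1 : 2 * w (some i) - w none = 0 := congrFun (congrArg Prod.fst h) i
      linarith
  · ext p
    constructor
    · intro hp
      obtain ⟨w, hw, rfl⟩ := eq_affineCombination_of_mem_affineSpan_of_fintype hp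
      rw [Finset.affineCombination_eq_linear_combination _ _ _ hw, key w]
      rw [Fintype.sum_option] at hw
      simp only [Hplane, Set.mem_setOf_eq, Finset.sum_sub_distrib, ← Finset.mul_sum,
        Finset.sum_const, Finset.card_univ, Fintype.card_fin, nsmul_eq_mul]
      linarith
    · intro hp
      simp only [Hplane, Set.mem_setOf_eq] at hp
      let w : Option (Fin n) → ℝ := fun o => o.elim p.2 (fun i => (p.1 i + p.2) / 2)
      have hw : ∑ o, w o = 1 := by
        rw [Fintype.sum_option]
        simp only [w, Option.elim, ← Finset.sum_div, Finset.sum_add_distrib,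
          Finset.sum_const, Finset.card_univ, Fintype.card_fin, nsmul_eq_mul]
        linarith
      have h := affineCombination_mem_affineSpan hw
        (fun o : Option (Fin n) => o.elim (bPt n) (yPt n))
      rw [Finset.affineCombination_eq_linear_combination _ _ _ hw, key w] at h
      have hpe : p = (fun i => 2 * w (some i) - w none, w none) := by
        ext j
        · simp only [w, Option.elim]
          ring
        · rfl
      rw [hpe]
      exact h
end

section
/- Let n ≥ 2 and let E = {e_i : i : Fin n} ∪ {−e_i : i : Fin n} ⊆ ℝⁿ. For a subset F ⊆ E, the following are equivalent: (1) the affine span of F is an affine hyperplane of ℝⁿ and E ∩ (affine span of F) = F; (2) either there is a sign function ε : Fin n → {1, −1} with F = {ε i • e_i : i : Fin n} (an LV-facet), or there is an index i with F = E \ {e_i, −e_i} (an interior hyperplane). -/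
/-- The vertex set `{e_i} ∪ {−e_i}` of the `n`-dimensional cross-polytope. -/
noncomputable def crossPolytopeVertices (n : ℕ) : Set (Fin n → ℝ) :=
  (Set.range fun i : Fin n => Pi.single i (1 : ℝ)) ∪
    (Set.range fun i : Fin n => -Pi.single i (1 : ℝ))

namespace CPaux

lemma const_on_span {n : ℕ} (F : Set (Fin n → ℝ)) (f : (Fin n → ℝ) →ₗ[ℝ] ℝ) (c : ℝ)
    (h : ∀ x ∈ F, f x = c) : ∀ x ∈ affineSpan ℝ F, f x = c := by
  intro x hx
  refine affineSpan_induction (p := fun x => f x = c) hx h ?_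
  intro a u v w hu hv hw
  simp only [vsub_eq_sub, vadd_eq_add, map_add, map_smul, map_sub, hu, hv, hw]
  simp

lemma dir_le_ker {n : ℕ} (F : Set (Fin n → ℝ)) (f : (Fin n → ℝ) →ₗ[ℝ] ℝ) (c : ℝ)
    (h : ∀ x ∈ F, f x = c) : (affineSpan ℝ F).direction ≤ LinearMap.ker f := by
  rw [direction_affineSpan, vectorSpan_def, Submodule.span_le]
  rintro _ ⟨a, ha, b, hb, rfl⟩
  simp [h a ha, h b hb]

lemma finrank_ker' {n : ℕ} (f : (Fin n → ℝ) →ₗ[ℝ] ℝ) (hf : f ≠ 0) :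
    Module.finrank ℝ (LinearMap.ker f) = n - 1 := by
  have := Module.Dual.finrank_ker_add_one_of_ne_zero (f := f) hf
  simp at this
  omega

lemma eq_top_of {n : ℕ} (W : Submodule ℝ (Fin n → ℝ))
    (h : ∀ j, (Pi.single j (1 : ℝ) : Fin n → ℝ) ∈ W) : W = ⊤ := by
  rw [eq_top_iff]
  rintro x -
  rw [pi_eq_sum_univ' x]
  refine Submodule.sum_mem _ fun i _ => W.smul_mem _ ?_
  convert h i using 1

lemma finrank_ge {n : ℕ} (W : Submodule ℝ (Fin n → ℝ)) (v : Fin n → ℝ)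
    (h : ∀ j, (Pi.single j (1 : ℝ) : Fin n → ℝ) ∈ W ⊔ Submodule.span ℝ {v}) :
    n - 1 ≤ Module.finrank ℝ W := by
  have h1 := eq_top_of _ h
  have h2 := Submodule.finrank_add_le_finrank_add_finrank W (Submodule.span ℝ {v})
  rw [h1, finrank_top] at h2
  have h3 := finrank_span_le_card (R := ℝ) ({v} : Set (Fin n → ℝ))
  simp at h2 h3
  omega

lemma mem_iff {n : ℕ} (x : Fin n → ℝ) : x ∈ crossPolytopeVertices n ↔
    ∃ i, x = Pi.single i 1 ∨ x = -Pi.single i 1 := by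
  unfold crossPolytopeVertices
  constructor
  · rintro (⟨i, rfl⟩ | ⟨i, rfl⟩)
    · exact ⟨i, Or.inl rfl⟩
    · exact ⟨i, Or.inr rfl⟩
  · rintro ⟨i, rfl | rfl⟩
    · exact Or.inl ⟨i, rfl⟩
    · exact Or.inr ⟨i, rfl⟩

lemma dir_sub {n : ℕ} {F : Set (Fin n → ℝ)} {a b : Fin n → ℝ} (ha : a ∈ F) (hb : b ∈ F) :
    a - b ∈ (affineSpan ℝ F).direction := by
  rw [direction_affineSpan]
  exact vsub_mem_vectorSpan ℝ ha hb

lemma dir_of_pair {n : ℕ} {F : Set (Fin n → ℝ)} {a b : Fin n → ℝ} (ha : a ∈ F) (ha' : -a ∈ F)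
    (hb : b ∈ F) : b ∈ (affineSpan ℝ F).direction := by
  have h1 := dir_sub hb ha
  have h2 := Submodule.smul_mem _ (1/2 : ℝ) (dir_sub ha ha')
  have h3 := Submodule.add_mem _ h1 h2
  convert h3 using 1
  ext j
  simp
  ring

lemma proj_zero_iff {n : ℕ} {x : Fin n → ℝ} (hx : x ∈ crossPolytopeVertices n) (i : Fin n) :
    x i = 0 ↔ ¬ (x = Pi.single i 1 ∨ x = -Pi.single i 1) := by
  constructor
  · rintro h (rfl | rfl) <;> simp at h
  · intro h
    obtain ⟨j, hj⟩ := (mem_iff x).1 hx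
    have hij : i ≠ j := by
      rintro rfl
      exact h hj
    rcases hj with rfl | rfl <;> simp [hij]

lemma proj_ne {n : ℕ} (i : Fin n) : (LinearMap.proj i : (Fin n → ℝ) →ₗ[ℝ] ℝ) ≠ 0 := by
  intro h
  have := LinearMap.congr_fun h (Pi.single i 1)
  simp at this

end CPaux

open CPaux in
/-- The hyperplane flats of the affine matroid of the cross-polytope vertices are
exactly the LV-facets `{ε_i e_i : i}` (for sign vectors `ε`) and the interior
hyperplanes `E \ {e_i, −e_i}`. -/
theorem crossPolytope_hyperplane_flats (n : ℕ) (hn : 2 ≤ n) (F : Set (Fin n → ℝ))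
    (hF : F ⊆ crossPolytopeVertices n) :
    (Module.finrank ℝ (affineSpan ℝ F).direction = n - 1 ∧
      crossPolytopeVertices n ∩ (affineSpan ℝ F : Set (Fin n → ℝ)) = F) ↔
    ((∃ ε : Fin n → ℝ, (∀ i, ε i = 1 ∨ ε i = -1) ∧
        F = Set.range fun i : Fin n => ε i • (Pi.single i (1 : ℝ) : Fin n → ℝ)) ∨
      (∃ i : Fin n,
        F = crossPolytopeVertices n \ {Pi.single i (1 : ℝ), -Pi.single i (1 : ℝ)})) := by
  constructor
  · rintro ⟨hd, hE⟩
    by_cases hmiss : ∃ i : Fin n, (Pi.single i 1 : Fin n → ℝ) ∉ F ∧ (-Pi.single i 1 : Fin n → ℝ) ∉ F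
    · right
      obtain ⟨i, h1, h2⟩ := hmiss
      refine ⟨i, ?_⟩
      have h0 : ∀ x ∈ F, (LinearMap.proj i : (Fin n → ℝ) →ₗ[ℝ] ℝ) x = 0 := by
        intro x hx
        refine (proj_zero_iff (hF hx) i).2 ?_
        rintro (rfl | rfl)
        · exact h1 hx
        · exact h2 hx
      have hker := Submodule.eq_of_le_of_finrank_eq (dir_le_ker F _ 0 h0)
        (hd.trans (finrank_ker' _ (proj_ne i)).symm)
      have hne : F.Nonempty := by
        rw [Set.nonempty_iff_ne_empty]
        rintro rfl
        rw [direction_affineSpan, vectorSpan_empty, finrank_bot] at hd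
        omega
      obtain ⟨p, hp⟩ := hne
      have hpS : p ∈ affineSpan ℝ F := subset_affineSpan ℝ F hp
      ext x
      constructor
      · intro hx
        refine ⟨hF hx, ?_⟩
        exact (proj_zero_iff (hF hx) i).1 (h0 x hx)
      · rintro ⟨hx, hx2⟩
        have hxi := (proj_zero_iff hx i).2 hx2
        rw [← hE]
        refine ⟨hx, ?_⟩
        have : x - p ∈ (affineSpan ℝ F).direction := by
          rw [hker]
          have := h0 p hp
          simp at this
          simp [hxi, this]
        have := AffineSubspace.vadd_mem_of_mem_direction this hpS
        simpa using this
    · left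
      push Not at hmiss
      have hpair : ∀ j : Fin n, (Pi.single j 1 : Fin n → ℝ) ∈ F → (-Pi.single j 1 : Fin n → ℝ) ∈ F → False := by
        intro j hj hj'
        have htop := eq_top_of (affineSpan ℝ F).direction (by
          intro k
          by_cases hk : (Pi.single k 1 : Fin n → ℝ) ∈ F
          · exact dir_of_pair hj hj' hk
          · have := dir_of_pair hj hj' (hmiss k hk)
            simpa using Submodule.neg_mem _ this)
        rw [htop, finrank_top] at hd
        simp at hd
        omega
      classical
      refine ⟨fun i => if (Pi.single i 1 : Fin n → ℝ) ∈ F then 1 else -1, ?_, ?_⟩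
      · intro i
        dsimp only
        split_ifs <;> simp
      · ext x
        constructor
        · intro hx
          obtain ⟨i, rfl | rfl⟩ := (mem_iff x).1 (hF hx)
          · exact ⟨i, by simp [hx]⟩
          · refine ⟨i, ?_⟩
            have : (Pi.single i 1 : Fin n → ℝ) ∉ F := fun h => hpair i h hx
            simp only [if_neg this, neg_smul, one_smul]
        · rintro ⟨i, rfl⟩
          dsimp only
          split_ifs with h
          · simpa using h
          · simpa only [neg_smul, one_smul] using hmiss i h
  · rintro (⟨ε, hε, rfl⟩ | ⟨i, rfl⟩)
    · set F := Set.range fun i : Fin n => ε i • (Pi.single i (1 : ℝ) : Fin n → ℝ) with hFdef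
      have hsq : ∀ i, ε i * ε i = 1 := by
        intro i
        rcases hε i with h | h <;> simp [h]
      let f : (Fin n → ℝ) →ₗ[ℝ] ℝ := ∑ i, ε i • LinearMap.proj i
      have hfs : ∀ i, f (Pi.single i 1) = ε i := by
        intro i
        simp [f, Pi.single_apply]
      have hf : ∀ x ∈ F, f x = 1 := by
        rintro _ ⟨i, rfl⟩
        simp only [map_smul, hfs, smul_eq_mul, hsq]
      have hmem : ∀ i, ε i • (Pi.single i (1 : ℝ) : Fin n → ℝ) ∈ F := fun i => ⟨i, rfl⟩
      let i0 : Fin n := ⟨0, by omega⟩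
      have hf0 : f ≠ 0 := by
        intro h
        have := hf _ (hmem i0)
        rw [h] at this
        simp at this
      refine ⟨le_antisymm ?_ ?_, ?_⟩
      · rw [← finrank_ker' f hf0]
        exact Submodule.finrank_mono (dir_le_ker F f 1 hf)
      · refine finrank_ge _ (ε i0 • (Pi.single i0 (1 : ℝ) : Fin n → ℝ)) fun j => ?_
        have h1 := Submodule.add_mem_sup (dir_sub (hmem j) (hmem i0))
          (Submodule.mem_span_singleton_self (R := ℝ) (ε i0 • (Pi.single i0 (1 : ℝ) : Fin n → ℝ)))
        rw [sub_add_cancel] at h1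
        have h2 := Submodule.smul_mem _ (ε j) h1
        rwa [smul_smul, hsq, one_smul] at h2
      · refine Set.Subset.antisymm ?_ fun x hx => ⟨hF hx, subset_affineSpan ℝ F hx⟩
        rintro x ⟨hx, hxS⟩
        have h1 := const_on_span F f 1 hf x hxS
        obtain ⟨i, rfl | rfl⟩ := (mem_iff x).1 hx
        · rw [hfs] at h1
          exact ⟨i, by simp [h1]⟩
        · rw [map_neg, hfs] at h1
          refine ⟨i, ?_⟩
          have : ε i = -1 := by linarith
          simp only [this, neg_smul, one_smul]
    · set F := crossPolytopeVertices n \ {Pi.single i (1 : ℝ), -Pi.single i (1 : ℝ)} with hFdef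
      have h0 : ∀ x ∈ F, (LinearMap.proj i : (Fin n → ℝ) →ₗ[ℝ] ℝ) x = 0 := by
        intro x hx
        exact (proj_zero_iff (hF hx) i).2 hx.2
      have hmem : ∀ x ∈ crossPolytopeVertices n, x i = 0 → x ∈ F :=
        fun x hx h => ⟨hx, (proj_zero_iff hx i).1 h⟩
      refine ⟨le_antisymm ?_ ?_, ?_⟩
      · rw [← finrank_ker' _ (proj_ne i)]
        exact Submodule.finrank_mono (dir_le_ker F _ 0 h0)
      · refine finrank_ge _ (Pi.single i (1 : ℝ) : Fin n → ℝ) fun j => ?_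
        by_cases hij : i = j
        · subst hij
          exact Submodule.mem_sup_right (Submodule.mem_span_singleton_self _)
        · refine Submodule.mem_sup_left ?_
          have ha : (Pi.single j 1 : Fin n → ℝ) ∈ F :=
            hmem _ ((mem_iff _).2 ⟨j, Or.inl rfl⟩) (by simp [hij])
          have hb : (-Pi.single j 1 : Fin n → ℝ) ∈ F :=
            hmem _ ((mem_iff _).2 ⟨j, Or.inr rfl⟩) (by simp [hij])
          exact dir_of_pair ha hb ha
      · refine Set.Subset.antisymm ?_ fun x hx => ⟨hF hx, subset_affineSpan ℝ F hx⟩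
        rintro x ⟨hx, hxS⟩
        exact hmem x hx (const_on_span F _ 0 h0 x hxS)
end

section
/- Let n ≥ 2 and let E = {e_i : i : Fin n} ∪ {−e_i : i : Fin n} ⊆ ℝⁿ. For a set S ⊆ ℝⁿ, let 𝓗(S) be the set of affine hyperplanes H of ℝⁿ such that H equals the affine span of H ∩ S. Then 𝓗(E ∪ {0}) = 𝓗(E), and this set has exactly 2ⁿ + n elements; in particular the point configurations E and E ∪ {0} span exactly the same affine hyperplanes. -/
/-- The affine hyperplanes of `ℝⁿ` spanned by their intersection with `S`. -/
def spannedHyperplanes (n : ℕ) (S : Set (Fin n → ℝ)) : Set (AffineSubspace ℝ (Fin n → ℝ)) :=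
  {H | Module.finrank ℝ H.direction = n - 1 ∧
    (H : Set (Fin n → ℝ)) =
      (affineSpan ℝ ((H : Set (Fin n → ℝ)) ∩ S) : Set (Fin n → ℝ))}

namespace CrossAux

/-- The functional `x ↦ a ⬝ x`. -/
def lf {n : ℕ} (a : Fin n → ℝ) : (Fin n → ℝ) →ₗ[ℝ] ℝ where
  toFun x := a ⬝ᵥ x
  map_add' x y := dotProduct_add a x y
  map_smul' c x := by simp

/-- The affine subspace `a ⬝ x = b`. -/
def hyp {n : ℕ} (a : Fin n → ℝ) (b : ℝ) : AffineSubspace ℝ (Fin n → ℝ) where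
  carrier := {x | a ⬝ᵥ x = b}
  smul_vsub_vadd_mem' c p q r hp hq hr := by
    simp only [Set.mem_setOf_eq] at *
    simp [dotProduct_add, dotProduct_sub, hp, hq, hr]

theorem mem_hyp {n : ℕ} (a : Fin n → ℝ) (b : ℝ) (x : Fin n → ℝ) :
    x ∈ hyp a b ↔ a ⬝ᵥ x = b := Iff.rfl

theorem direction_hyp {n : ℕ} (a : Fin n → ℝ) (b : ℝ) (p : Fin n → ℝ) (hp : p ∈ hyp a b) :
    (hyp a b).direction = LinearMap.ker (lf a) := by
  ext v
  rw [← AffineSubspace.vadd_mem_iff_mem_direction v hp, mem_hyp, LinearMap.mem_ker]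
  rw [mem_hyp] at hp
  simp [lf, dotProduct_add, hp]

theorem finrank_hyp {n : ℕ} (a : Fin n → ℝ) (b : ℝ) (p : Fin n → ℝ) (hp : p ∈ hyp a b)
    (ha : a ≠ 0) : Module.finrank ℝ (hyp a b).direction = n - 1 := by
  rw [direction_hyp a b p hp]
  have h0 : lf a ≠ 0 := by
    intro h
    apply ha
    ext i
    have := LinearMap.congr_fun h (Pi.single i 1)
    simpa [lf] using this
  have := Module.Dual.finrank_ker_add_one_of_ne_zero (f := lf a) h0
  simp at this
  omega

theorem exists_hyp {n : ℕ} (hn : 2 ≤ n) (H : AffineSubspace ℝ (Fin n → ℝ))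
    (hH : Module.finrank ℝ H.direction = n - 1) : ∃ a b, a ≠ 0 ∧ H = hyp a b := by
  have hne : (H : Set (Fin n → ℝ)).Nonempty := by
    rw [Set.nonempty_iff_ne_empty]
    intro h
    rw [AffineSubspace.coe_eq_bot_iff] at h
    subst h
    rw [AffineSubspace.direction_bot, finrank_bot] at hH
    omega
  obtain ⟨p, hp⟩ := hne
  have hlt : H.direction < ⊤ := by
    rw [lt_top_iff_ne_top]
    intro h
    rw [h] at hH
    simp at hH
    omega
  obtain ⟨f, hf, hle⟩ := Submodule.exists_le_ker_of_lt_top _ hlt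
  have hfr := Module.Dual.finrank_ker_add_one_of_ne_zero (f := f) hf
  simp at hfr
  have heq : H.direction = LinearMap.ker f :=
    Submodule.eq_of_le_of_finrank_eq hle (by omega)
  have hfa : ∀ x, f x = (fun i => f (Pi.single i 1)) ⬝ᵥ x := by
    intro x
    rw [LinearMap.pi_apply_eq_sum_univ f x]
    simp only [dotProduct, smul_eq_mul]
    refine Finset.sum_congr rfl fun i _ => ?_
    rw [mul_comm]
    congr 2
    ext j
    simp [Pi.single_apply, eq_comm]
  refine ⟨fun i => f (Pi.single i 1), f p, ?_, ?_⟩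
  · intro h
    apply hf
    ext i
    simpa using congrFun h i
  · ext x
    rw [mem_hyp, ← hfa, ← AffineSubspace.vsub_right_mem_direction_iff_mem hp, heq,
      LinearMap.mem_ker]
    simp [sub_eq_zero]

/-- signs -/
def sg {n : ℕ} (s : Fin n → Bool) : Fin n → ℝ := fun i => if s i then 1 else -1

theorem sg_mul {n : ℕ} (s : Fin n → Bool) (i : Fin n) : sg s i * sg s i = 1 := by
  unfold sg; split_ifs <;> norm_num

/-- The parametrization. -/
def F (n : ℕ) : (Fin n → Bool) ⊕ Fin n → AffineSubspace ℝ (Fin n → ℝ)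
  | .inl s => hyp (sg s) 1
  | .inr i => hyp (Pi.single i 1) 0

theorem F_inj (n : ℕ) : Function.Injective (F n) := by
  have h0 : ∀ s i, F n (.inl s) ≠ F n (.inr i) := by
    intro s i h
    have : (0 : Fin n → ℝ) ∈ F n (.inl s) := by rw [h]; simp [F, mem_hyp]
    simp [F, mem_hyp] at this
  rintro (s | i) (t | j) h
  · congr 1
    ext1 i
    have : Pi.single i (sg s i) ∈ F n (.inl t) := by
      rw [← h]; simp [F, mem_hyp, sg_mul]
    simp only [F, mem_hyp, dotProduct_single, sg] at this
    cases hs : s i <;> cases ht : t i <;> simp [hs, ht] at this ⊢ <;> norm_num at this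
  · exact absurd h (h0 _ _)
  · exact absurd h.symm (h0 _ _)
  · congr 1
    by_contra hij
    have : Pi.single i 1 ∈ F n (.inr i) := by
      rw [h]; simp [F, mem_hyp, Ne.symm hij, hij]
    simp [F, mem_hyp] at this

theorem span_sub {n : ℕ} (H : AffineSubspace ℝ (Fin n → ℝ)) (S : Set (Fin n → ℝ)) :
    affineSpan ℝ ((H : Set (Fin n → ℝ)) ∩ S) ≤ H :=
  affineSpan_le.2 Set.inter_subset_left

theorem F_mem {n : ℕ} (hn : 2 ≤ n) (u) :
    F n u ∈ spannedHyperplanes n (crossPolytopeVertices n) := by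
  rcases u with s | i
  · have hmem : ∀ i, Pi.single i (sg s i) ∈ F n (.inl s) := fun i => by
      simp [F, mem_hyp, sg_mul]
    have i0 : Fin n := ⟨0, by omega⟩
    refine ⟨finrank_hyp _ _ _ (hmem i0) ?_, ?_⟩
    · intro h
      have := sg_mul s i0
      simp [h] at this
    · refine Set.Subset.antisymm ?_ (span_sub _ _)
      intro x hx
      have hE : Set.range (fun i => (Pi.single i (sg s i) : Fin n → ℝ)) ⊆
          (F n (.inl s) : Set _) ∩ crossPolytopeVertices n := by
        rintro _ ⟨i, rfl⟩
        refine ⟨hmem i, ?_⟩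
        unfold sg
        cases h : s i
        · right; exact ⟨i, by simp [h, Pi.single_neg]⟩
        · left; exact ⟨i, by simp [h]⟩
      apply affineSpan_mono ℝ hE
      have hx1 : ∑ i, sg s i * x i = 1 := hx
      have hc := affineCombination_mem_affineSpan (k := ℝ) hx1
        (fun i => (Pi.single i (sg s i) : Fin n → ℝ))
      rw [Finset.affineCombination_eq_linear_combination _ _ _ hx1] at hc
      convert hc using 1
      ext j
      simp only [Finset.sum_apply, Pi.smul_apply, Pi.single_apply, smul_eq_mul]
      simp
      have := sg_mul s j
      linear_combination (-x j) * this
  · refine ⟨finrank_hyp _ _ 0 (by simp [mem_hyp]) (by simp), ?_⟩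
    refine Set.Subset.antisymm ?_ (span_sub _ _)
    intro x hx
    set Q := affineSpan ℝ ((F n (.inr i) : Set _) ∩ crossPolytopeVertices n) with hQ
    have hp : ∀ k, k ≠ i → Pi.single k 1 ∈ Q := fun k hk =>
      subset_affineSpan ℝ _ ⟨by simp [F, mem_hyp, hk, hk.symm], Or.inl ⟨k, rfl⟩⟩
    have hm : ∀ k, k ≠ i → -Pi.single k 1 ∈ Q := fun k hk =>
      subset_affineSpan ℝ _ ⟨by simp [F, mem_hyp, hk, hk.symm], Or.inr ⟨k, rfl⟩⟩
    have : Nontrivial (Fin n) := Fin.nontrivial_iff_two_le.2 hn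
    obtain ⟨j, hj⟩ := exists_ne i
    have hz : (0 : Fin n → ℝ) ∈ Q := by
      have := AffineMap.lineMap_mem (1/2 : ℝ) (hp j hj) (hm j hj)
      convert this using 1
      ext k
      simp [AffineMap.lineMap_apply]
      ring
    have hd : ∀ k, k ≠ i → Pi.single k 1 ∈ Q.direction := fun k hk => by
      simpa using AffineSubspace.vsub_mem_direction (hp k hk) hz
    have hxi : x i = 0 := by simpa [F, mem_hyp] using hx
    have hs : ∑ k, x k • (Pi.single k 1 : Fin n → ℝ) ∈ Q.direction := by
      refine Submodule.sum_mem _ fun k _ => ?_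
      by_cases hk : k = i
      · subst hk; simp [hxi]
      · exact Submodule.smul_mem _ _ (hd k hk)
    rw [← pi_eq_sum_univ'] at hs
    simpa using AffineSubspace.vadd_mem_of_mem_direction hs hz

theorem mem_range {n : ℕ} (hn : 2 ≤ n) (H)
    (hH : H ∈ spannedHyperplanes n (crossPolytopeVertices n ∪ {0})) : H ∈ Set.range (F n) := by
  obtain ⟨h1, h2⟩ := hH
  obtain ⟨a, b, ha, rfl⟩ := exists_hyp hn _ h1
  have key : ∀ i, a i ≠ b → a i ≠ -b → ∀ x, a ⬝ᵥ x = b → x i = 0 := by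
    intro i hi1 hi2 x hx
    have hle : affineSpan ℝ ((hyp a b : Set (Fin n → ℝ)) ∩ (crossPolytopeVertices n ∪ {0}))
        ≤ hyp (Pi.single i 1) 0 := by
      rw [affineSpan_le]
      rintro y ⟨hy, (⟨k, rfl⟩ | ⟨k, rfl⟩) | rfl⟩
      · have hy' : a k = b := by simpa [mem_hyp] using hy
        have : k ≠ i := by rintro rfl; exact hi1 hy'
        simp [mem_hyp, this, this.symm]
      · have hy' : -a k = b := by simpa [mem_hyp] using hy
        have : k ≠ i := by rintro rfl; exact hi2 (by linarith)
        simp [mem_hyp, this, this.symm]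
      · simp [mem_hyp]
    have hx' : x ∈ (hyp a b : Set (Fin n → ℝ)) := hx
    rw [h2] at hx'
    simpa [mem_hyp] using hle hx'
  obtain ⟨j, hj⟩ := Function.ne_iff.1 ha
  simp only [Pi.zero_apply] at hj
  by_cases hb : b = 0
  · subst hb
    refine ⟨.inr j, ?_⟩
    have hz : ∀ i, i ≠ j → a i = 0 := by
      intro i hij
      have := key j hj (by simpa using hj) (Pi.single i (-(a j)) + Pi.single j (a i))
        (by simp [dotProduct_add]; ring)
      simpa [hij, hij.symm] using this
    have haj : a = Pi.single j (a j) := by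
      ext i
      by_cases hij : i = j
      · subst hij; simp
      · simp [hij, hz i hij]
    ext x
    simp only [F, mem_hyp]
    rw [haj]
    simp [hj]
  · have hall : ∀ i, a i = b ∨ a i = -b := by
      intro i
      by_contra! h
      by_cases hi : a i = 0
      · have hij : i ≠ j := by rintro rfl; exact hj hi
        have := key i h.1 h.2 (Pi.single i 1 + Pi.single j (b / a j))
          (by simp [dotProduct_add, hi]; field_simp)
        simp [hij, hij.symm] at this
      · have := key i h.1 h.2 (Pi.single i (b / a i)) (by simp; field_simp)
        simp [hi, hb] at this
    classical
    refine ⟨.inl fun i => decide (a i = b), ?_⟩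
    have hab : a = b • sg (fun i => decide (a i = b)) := by
      ext i
      by_cases h : a i = b
      · simp [sg, h]
      · simp [sg, h]
        exact (hall i).resolve_left h
    ext x
    simp only [F, mem_hyp]
    conv_rhs => rw [hab]
    rw [smul_dotProduct, smul_eq_mul]
    constructor
    · intro h; rw [h, mul_one]
    · intro h; exact mul_left_cancel₀ hb (by rw [h, mul_one])

theorem sub_ext {n : ℕ} : spannedHyperplanes n (crossPolytopeVertices n) ⊆
    spannedHyperplanes n (crossPolytopeVertices n ∪ {0}) := by
  rintro H ⟨h1, h2⟩
  refine ⟨h1, Set.Subset.antisymm ?_ (span_sub _ _)⟩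
  intro x hx
  rw [h2] at hx
  exact affineSpan_mono ℝ (Set.inter_subset_inter_right _ Set.subset_union_left) hx

end CrossAux

/-- The configurations `E ∪ {0}` and `E` (the cross-polytope vertices, with or without
the origin) span exactly the same affine hyperplanes, and there are `2ⁿ + n` of them. -/
theorem crossPolytope_extension_hyperplanes (n : ℕ) (hn : 2 ≤ n) :
    spannedHyperplanes n (crossPolytopeVertices n ∪ {0}) =
      spannedHyperplanes n (crossPolytopeVertices n) ∧
    (spannedHyperplanes n (crossPolytopeVertices n)).ncard = 2 ^ n + n := by
  have hA : spannedHyperplanes n (crossPolytopeVertices n ∪ {0}) = Set.range (CrossAux.F n) := by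
    refine Set.Subset.antisymm (fun H hH => CrossAux.mem_range hn H hH) ?_
    rintro _ ⟨u, rfl⟩
    exact CrossAux.sub_ext (CrossAux.F_mem hn u)
  have hB : spannedHyperplanes n (crossPolytopeVertices n) = Set.range (CrossAux.F n) := by
    refine Set.Subset.antisymm (fun H hH => CrossAux.mem_range hn H (CrossAux.sub_ext hH)) ?_
    rintro _ ⟨u, rfl⟩
    exact CrossAux.F_mem hn u
  refine ⟨hA.trans hB.symm, ?_⟩
  rw [hB, ← Set.image_univ, Set.ncard_image_of_injective _ (CrossAux.F_inj n), Set.ncard_univ,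
    Nat.card_eq_fintype_card]
  simp
end

section
/- Let n ≥ 1, let w : Finset (Fin n) → ℝⁿ be a realized oriented cube, let f : ℝⁿ → ℝ be an affine map, and let S := {A : Finset (Fin n) | f (w A) = 0}; assume the zero set of f meets the configuration exactly in the flat it spans, i.e., {w A : A ∈ S} = (range of w) ∩ {p : f p = 0}. Fix i : Fin n. (i) If S is anti-parallel to i (A ∈ S implies A ∆ {i} ∉ S), then either [f (w (A ∆ {i})) > 0 for every A ∈ S with i ∉ A, and f (w (A ∆ {i})) < 0 for every A ∈ S with i ∈ A], or the same statement with the two inequalities exchanged. (ii) If S is nonempty and parallel to i (A ∈ S iff A ∆ {i} ∈ S), then for every A : Finset (Fin n), f (w A) and f (w (A ∆ {i})) have the same sign (both positive, both negative, or both zero). -/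
theorem cube_cross_aux (n : ℕ) (w : Finset (Fin n) → (Fin n → ℝ)) (hw : IsRealizedCube n w)
    (f : (Fin n → ℝ) →ᵃ[ℝ] ℝ) (i : Fin n) (A B : Finset (Fin n)) (hAB : A ≠ B)
    (hi : i ∈ A ↔ i ∈ B) : ∃ a b c d : ℝ, 0 < a ∧ 0 < b ∧ 0 < c ∧ 0 < d ∧
      a * f (w A) + b * f (w (symmDiff B {i})) = c * f (w B) + d * f (w (symmDiff A {i})) := by
  have hd : Disjoint (symmDiff A B) {i} := by
    rw [Finset.disjoint_singleton_right, Finset.mem_symmDiff]; tauto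
  have hne : (symmDiff A B).Nonempty := by
    rw [Finset.nonempty_iff_ne_empty]
    intro h
    exact hAB (symmDiff_eq_bot.mp h)
  obtain ⟨p, ⟨a, b, ha, hb, hab, h1⟩, ⟨c, d, hc, hd', hcd, h2⟩⟩ :=
    hw.rect A (symmDiff A B) {i} hd hne (Finset.singleton_nonempty i)
  have e1 : symmDiff A (symmDiff A B ∪ {i}) = symmDiff B {i} := by
    have : symmDiff A B ∪ {i} = symmDiff (symmDiff A B) {i} := hd.symmDiff_eq_sup.symm
    rw [this, ← symmDiff_assoc, symmDiff_symmDiff_cancel_left]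
  rw [e1] at h1
  rw [symmDiff_symmDiff_cancel_left] at h2
  refine ⟨a, b, c, d, ha, hb, hc, hd', ?_⟩
  have k1 := Convex.combo_affine_apply (f := f) (x := w A) (y := w (symmDiff B {i})) hab
  have k2 := Convex.combo_affine_apply (f := f) (x := w B) (y := w (symmDiff A {i})) hcd
  rw [h1] at k1
  rw [h2] at k2
  simpa using k1.symm.trans k2

/-- Sign behaviour of a covector of a realized oriented cube across a flat:
let `f` be an affine functional whose zero set meets the configuration exactly in the
flat it spans, and let `S = {A | f (w A) = 0}`. If `S` is anti-parallel to `i`, then the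
reflections in direction `i` of the part of `S` in the facet `{A | i ∉ A}` all get one
strict sign and those of the part in `{A | i ∈ A}` the opposite sign; if `S` is nonempty
and parallel to `i`, then `f ∘ w` takes the same sign on `A` and `A ∆ {i}` for all `A`. -/
theorem cube_covector_signs (n : ℕ) (hn : 1 ≤ n)
    (w : Finset (Fin n) → (Fin n → ℝ)) (hw : IsRealizedCube n w)
    (f : (Fin n → ℝ) →ᵃ[ℝ] ℝ)
    (hflat : w '' {A | f (w A) = 0} = Set.range w ∩ {p | f p = 0}) (i : Fin n) :
    ((∀ A : Finset (Fin n), f (w A) = 0 → f (w (symmDiff A {i})) ≠ 0) →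
      (((∀ A : Finset (Fin n), f (w A) = 0 → i ∉ A → 0 < f (w (symmDiff A {i}))) ∧
        (∀ A : Finset (Fin n), f (w A) = 0 → i ∈ A → f (w (symmDiff A {i})) < 0)) ∨
       ((∀ A : Finset (Fin n), f (w A) = 0 → i ∉ A → f (w (symmDiff A {i})) < 0) ∧
        (∀ A : Finset (Fin n), f (w A) = 0 → i ∈ A → 0 < f (w (symmDiff A {i})))))) ∧
    ((∃ A : Finset (Fin n), f (w A) = 0) →
      (∀ A : Finset (Fin n), f (w A) = 0 ↔ f (w (symmDiff A {i})) = 0) →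
      ∀ A : Finset (Fin n),
        SignType.sign (f (w A)) = SignType.sign (f (w (symmDiff A {i})))) := by
  have inv : ∀ A : Finset (Fin n), symmDiff (symmDiff A {i}) {i} = A :=
    fun A => symmDiff_symmDiff_cancel_right _ _
  have mem : ∀ A : Finset (Fin n), i ∈ symmDiff A {i} ↔ i ∉ A := by
    intro A; simp [Finset.mem_symmDiff]
  have sgn : ∀ b d x y : ℝ, 0 < b → 0 < d → b * x = d * y →
      SignType.sign x = SignType.sign y := by
    intro b d x y hb hd h
    have := congrArg SignType.sign h
    simpa [sign_mul, sign_pos hb, sign_pos hd] using this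
  have sgn' : ∀ b d x y : ℝ, 0 < b → 0 < d → 0 = b * x + d * y →
      SignType.sign x = - SignType.sign y := by
    intro b d x y hb hd h
    rw [← Left.sign_neg]
    exact sgn b d x (-y) hb hd (by linarith)
  refine ⟨fun hanti => ?_, ?_⟩
  · have same : ∀ A B : Finset (Fin n), f (w A) = 0 → f (w B) = 0 → (i ∈ A ↔ i ∈ B) →
        SignType.sign (f (w (symmDiff A {i}))) = SignType.sign (f (w (symmDiff B {i}))) := by
      intro A B hA hB hi
      by_cases hAB : A = B
      · rw [hAB]
      obtain ⟨a, b, c, d, -, hb, -, hd, h⟩ := cube_cross_aux n w hw f i A B hAB hi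
      rw [hA, hB] at h
      exact (sgn b d _ _ hb hd (by linarith)).symm
    have opp : ∀ A B : Finset (Fin n), f (w A) = 0 → f (w B) = 0 → (i ∈ A ↔ i ∉ B) →
        SignType.sign (f (w (symmDiff A {i}))) = - SignType.sign (f (w (symmDiff B {i}))) := by
      intro A B hA hB hi
      have hAB : A ≠ symmDiff B {i} := by
        rintro rfl
        exact hanti B hB hA
      obtain ⟨a, b, c, d, -, hb, hc, hd, h⟩ :=
        cube_cross_aux n w hw f i A (symmDiff B {i}) hAB (by rw [mem]; exact hi)
      rw [inv, hA, hB] at h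
      exact sgn' d c _ _ hd hc (by linarith)
    by_cases hS : ∃ A, f (w A) = 0
    · obtain ⟨A, hA⟩ := hS
      have key : ∀ B, f (w B) = 0 → (i ∈ A ↔ i ∈ B) → 
        SignType.sign (f (w (symmDiff A {i}))) = SignType.sign (f (w (symmDiff B {i}))) :=
        fun B hB h => same A B hA hB h
      rcases lt_or_gt_of_ne (hanti A hA) with h0 | h0 <;> by_cases hiA : i ∈ A
      · left
        constructor <;> intro B hB hi
        · have := opp B A hB hA (by tauto)
          rw [sign_neg h0] at this
          exact sign_eq_one_iff.mp (by simpa using this)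
        · have := same B A hB hA (by tauto)
          rw [sign_neg h0] at this
          exact sign_eq_neg_one_iff.mp this
      · right
        constructor <;> intro B hB hi
        · have := same B A hB hA (by tauto)
          rw [sign_neg h0] at this
          exact sign_eq_neg_one_iff.mp this
        · have := opp B A hB hA (by tauto)
          rw [sign_neg h0] at this
          exact sign_eq_one_iff.mp (by simpa using this)
      · right
        constructor <;> intro B hB hi
        · have := opp B A hB hA (by tauto)
          rw [sign_pos h0] at this
          exact sign_eq_neg_one_iff.mp this
        · have := same B A hB hA (by tauto)
          rw [sign_pos h0] at this
          exact sign_eq_one_iff.mp this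
      · left
        constructor <;> intro B hB hi
        · have := same B A hB hA (by tauto)
          rw [sign_pos h0] at this
          exact sign_eq_one_iff.mp this
        · have := opp B A hB hA (by tauto)
          rw [sign_pos h0] at this
          exact sign_eq_neg_one_iff.mp this
    · left
      exact ⟨fun A hA => (hS ⟨A, hA⟩).elim, fun A hA => (hS ⟨A, hA⟩).elim⟩
  · rintro ⟨A₀, hA₀⟩ hpar D
    obtain ⟨A, hA, hi⟩ : ∃ A, f (w A) = 0 ∧ (i ∈ A ↔ i ∈ D) := by
      by_cases h : i ∈ A₀ ↔ i ∈ D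
      · exact ⟨A₀, hA₀, h⟩
      · exact ⟨symmDiff A₀ {i}, (hpar A₀).mp hA₀, by rw [mem]; tauto⟩
    have hA' := (hpar A).mp hA
    by_cases hAD : A = D
    · subst hAD
      rw [hA, hA']
    obtain ⟨a, b, c, d, -, hb, hc, hd, h⟩ := cube_cross_aux n w hw f i A D hAD hi
    rw [hA, hA'] at h
    exact sgn c b _ _ hc hb (by linarith)
end

section
/- Let d ≥ 1 and let a₁, b₁, a₂, b₂, a₃, b₃ ∈ ℝᵈ be such that each of the three open segments joining aₖ to bₖ (k = 1, 2, 3) meets each of the other two, and the six points are not coplanar (they are not contained in any affine subspace of dimension at most 2). Then the three open segments have a point in common. -/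
lemma seg_aux {d : ℕ} {a b x y : Fin d → ℝ} (hx : x ∈ openSegment ℝ a b)
    (hy : y ∈ openSegment ℝ a b) (hxy : x ≠ y) :
    a ∈ affineSpan ℝ ({x, y} : Set (Fin d → ℝ)) ∧
    b ∈ affineSpan ℝ ({x, y} : Set (Fin d → ℝ)) := by
  rw [openSegment_eq_image_lineMap] at hx hy
  obtain ⟨s, -, rfl⟩ := hx
  obtain ⟨t, -, rfl⟩ := hy
  have hst : t - s ≠ 0 := by
    intro h
    exact hxy (by rw [sub_eq_zero.mp h])
  constructor
  · convert AffineMap.lineMap_mem_affineSpan_pair (-s / (t - s)) _ _ using 1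
    ext i
    simp [AffineMap.lineMap_apply]
    field_simp
    ring
  · convert AffineMap.lineMap_mem_affineSpan_pair ((1 - s) / (t - s)) _ _ using 1
    ext i
    simp [AffineMap.lineMap_apply]
    field_simp
    ring

/-- If three open segments in `ℝᵈ` pairwise meet and their six endpoints are not
contained in any affine subspace of dimension at most `2`, then the three open
segments have a point in common. -/
theorem three_segments_concurrent (d : ℕ) (hd : 1 ≤ d)
    (a₁ b₁ a₂ b₂ a₃ b₃ : Fin d → ℝ)
    (h12 : (openSegment ℝ a₁ b₁ ∩ openSegment ℝ a₂ b₂).Nonempty)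
    (h13 : (openSegment ℝ a₁ b₁ ∩ openSegment ℝ a₃ b₃).Nonempty)
    (h23 : (openSegment ℝ a₂ b₂ ∩ openSegment ℝ a₃ b₃).Nonempty)
    (hnc : ¬ Module.finrank ℝ
      (affineSpan ℝ ({a₁, b₁, a₂, b₂, a₃, b₃} : Set (Fin d → ℝ))).direction ≤ 2) :
    (openSegment ℝ a₁ b₁ ∩ openSegment ℝ a₂ b₂ ∩ openSegment ℝ a₃ b₃).Nonempty := by
  obtain ⟨p, hp1, hp2⟩ := h12
  obtain ⟨q, hq1, hq3⟩ := h13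
  obtain ⟨r, hr2, hr3⟩ := h23
  by_cases hpq : p = q
  · subst hpq
    exact ⟨p, ⟨hp1, hp2⟩, hq3⟩
  by_cases hpr : p = r
  · subst hpr
    exact ⟨p, ⟨hp1, hp2⟩, hr3⟩
  by_cases hqr : q = r
  · subst hqr
    exact ⟨q, ⟨hq1, hr2⟩, hq3⟩
  exfalso
  apply hnc
  obtain ⟨ha1, hb1⟩ := seg_aux hp1 hq1 hpq
  obtain ⟨ha2, hb2⟩ := seg_aux hp2 hr2 hpr
  obtain ⟨ha3, hb3⟩ := seg_aux hq3 hr3 hqr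
  have m1 : affineSpan ℝ ({p, q} : Set (Fin d → ℝ)) ≤ affineSpan ℝ {p, q, r} :=
    affineSpan_mono ℝ (by intro x; simp; tauto)
  have m2 : affineSpan ℝ ({p, r} : Set (Fin d → ℝ)) ≤ affineSpan ℝ {p, q, r} :=
    affineSpan_mono ℝ (by intro x; simp; tauto)
  have m3 : affineSpan ℝ ({q, r} : Set (Fin d → ℝ)) ≤ affineSpan ℝ {p, q, r} :=
    affineSpan_mono ℝ (by intro x; simp; tauto)
  have key : affineSpan ℝ ({a₁, b₁, a₂, b₂, a₃, b₃} : Set (Fin d → ℝ)) ≤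
      affineSpan ℝ {p, q, r} := by
    rw [affineSpan_le]
    rintro x (rfl | rfl | rfl | rfl | rfl | rfl)
    exacts [m1 ha1, m1 hb1, m2 ha2, m2 hb2, m3 ha3, m3 hb3]
  refine (Submodule.finrank_mono (AffineSubspace.direction_le key)).trans ?_
  rw [direction_affineSpan]
  exact (coplanar_triple ℝ p q r).finrank_le_two
end

section
/- Let n ≥ 2 and let w : Finset (Fin n) → ℝⁿ be a realized oriented cube. Then for every i : Fin n, either (concurrent case) there exists a point p ∈ ℝⁿ lying on the line through w A and w (insert i A) for every A : Finset (Fin n) with i ∉ A, or (parallel case) for all A, B : Finset (Fin n) with i ∉ A and i ∉ B, the edge directions w (insert i A) − w A and w (insert i B) − w B are linearly dependent (all edges of direction i are parallel). In other words, the lines carrying all edges of the cube in direction i pass through a common point of real projective n-space. -/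
lemma cube_aux_prop {V : Type*} [AddCommGroup V] [Module ℝ V] [FiniteDimensional ℝ V]
    (P L : Submodule ℝ V) (hL : Module.finrank ℝ L ≤ 2) (hP : ¬ L ≤ P)
    (x y : V) (hx : x ∈ P) (hx' : x ∈ L) (hy : y ∈ P) (hy' : y ∈ L) (hx0 : x ≠ 0) :
    ∃ c : ℝ, y = c • x := by
  have hlt : P ⊓ L < L := lt_of_le_of_ne inf_le_right (fun h => hP (h ▸ inf_le_left))
  have h1 := Submodule.finrank_lt_finrank_of_lt hlt
  have h2 : Module.finrank ℝ (P ⊓ L : Submodule ℝ V) ≤ 1 := by omega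
  obtain ⟨z, hz⟩ := finrank_le_one_iff.mp h2
  obtain ⟨a, ha⟩ := hz ⟨x, hx, hx'⟩
  obtain ⟨b, hb⟩ := hz ⟨y, hy, hy'⟩
  have ha' : a • (z : V) = x := congrArg Subtype.val ha
  have hb' : b • (z : V) = y := congrArg Subtype.val hb
  have ha0 : a ≠ 0 := by
    rintro rfl
    simp at ha'
    exact hx0 ha'.symm
  refine ⟨b / a, ?_⟩
  rw [← ha', ← hb', smul_smul, div_mul_cancel₀ _ ha0]

lemma cube_aux_common {V ι : Type*} [AddCommGroup V] [Module ℝ V] [FiniteDimensional ℝ V]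
    (L : ι → Submodule ℝ V) (hL : ∀ a, Module.finrank ℝ (L a) ≤ 2)
    (hpair : ∀ a b, ∃ v, v ≠ 0 ∧ v ∈ L a ∧ v ∈ L b)
    (hspan : ∀ U : Submodule ℝ V, (∀ a, L a ≤ U) → 3 < Module.finrank ℝ U) :
    ∃ v, v ≠ 0 ∧ ∀ a, v ∈ L a := by
  by_cases hne : Nonempty ι
  swap
  · have := hspan ⊥ (fun a => (hne ⟨a⟩).elim)
    simp at this
  obtain ⟨a₀⟩ := hne
  by_cases hall : ∀ b, L b ≤ L a₀
  · have := hspan _ hall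
    have := hL a₀
    omega
  push Not at hall
  obtain ⟨b₀, hb₀⟩ := hall
  obtain ⟨v, hv, hva, hvb⟩ := hpair a₀ b₀
  have hinf : 1 ≤ Module.finrank ℝ (L a₀ ⊓ L b₀ : Submodule ℝ V) :=
    Submodule.one_le_finrank_iff.mpr (fun h => hv (by
      have : v ∈ L a₀ ⊓ L b₀ := ⟨hva, hvb⟩
      rw [h] at this
      simpa using this))
  have hU : Module.finrank ℝ (L a₀ ⊔ L b₀ : Submodule ℝ V) ≤ 3 := by
    have := Submodule.finrank_sup_add_finrank_inf_eq (L a₀) (L b₀)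
    have := hL a₀
    have := hL b₀
    omega
  have key : ∀ c, ¬ L c ≤ L a₀ ⊔ L b₀ → v ∈ L c := by
    intro c hc
    obtain ⟨x, hx, hxa, hxc⟩ := hpair a₀ c
    obtain ⟨y, hy, hyb, hyc⟩ := hpair b₀ c
    obtain ⟨k, hk⟩ := cube_aux_prop _ _ (hL c) hc y x
      (Submodule.mem_sup_right hyb) hyc (Submodule.mem_sup_left hxa) hxc hy
    have hxb : x ∈ L b₀ := hk ▸ (L b₀).smul_mem k hyb
    obtain ⟨m, hm⟩ := cube_aux_prop _ _ (hL b₀) hb₀ x v hxa hxb hva hvb hx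
    exact hm ▸ (L c).smul_mem m hxc
  have hex : ∃ c, ¬ L c ≤ L a₀ ⊔ L b₀ := by
    by_contra hcon
    push Not at hcon
    have := hspan _ hcon
    omega
  obtain ⟨c, hc⟩ := hex
  refine ⟨v, hv, fun d => ?_⟩
  by_cases hd : L d ≤ L a₀ ⊔ L b₀
  · obtain ⟨z, hz, hzd, hzc⟩ := hpair d c
    obtain ⟨m, hm⟩ := cube_aux_prop _ _ (hL c) hc z v (hd hzd) hzc
      (Submodule.mem_sup_left hva) (key c hc) hz
    exact hm ▸ (L d).smul_mem m hzd
  · exact key d hd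

theorem cube_edges_meet_at_projective_point (n : ℕ) (hn : 2 ≤ n)
    (w : Finset (Fin n) → (Fin n → ℝ)) (hw : IsRealizedCube n w) (i : Fin n) :
    (∃ p : Fin n → ℝ, ∀ A : Finset (Fin n), i ∉ A →
      p ∈ affineSpan ℝ ({w A, w (insert i A)} : Set (Fin n → ℝ))) ∨
    (∀ A B : Finset (Fin n), i ∉ A → i ∉ B →
      ¬ LinearIndependent ℝ ![w (insert i A) - w A, w (insert i B) - w B]) := by
  classical
  let L : {A : Finset (Fin n) // i ∉ A} → Submodule ℝ (ℝ × (Fin n → ℝ)) := fun A =>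
    Submodule.span ℝ {((1 : ℝ), w A.1), ((1 : ℝ), w (insert i A.1))}
  have hL : ∀ a, Module.finrank ℝ (L a) ≤ 2 := by
    intro a
    have h := finrank_span_finset_le_card (R := ℝ)
      ({((1 : ℝ), w a.1), ((1 : ℝ), w (insert i a.1))} : Finset (ℝ × (Fin n → ℝ)))
    rw [Finset.coe_pair] at h
    exact h.trans Finset.card_le_two
  have hdist : ∀ A : Finset (Fin n), i ∉ A → w A ≠ w (insert i A) := by
    intro A hA h
    have := hw.inj h
    exact hA (this ▸ Finset.mem_insert_self i A)
  have hpair : ∀ a b, ∃ v, v ≠ 0 ∧ v ∈ L a ∧ v ∈ L b := by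
    rintro ⟨A, hA⟩ ⟨B, hB⟩
    by_cases hAB : A = B
    · subst hAB
      refine ⟨((1 : ℝ), w A), by simp, ?_, ?_⟩ <;>
      exact Submodule.subset_span (by simp)
    have hi : i ∉ symmDiff A B := by simp [Finset.mem_symmDiff, hA, hB]
    have hr := hw.rect A {i} (symmDiff A B) (by simpa using hi) (by simp)
      (Finset.nonempty_iff_ne_empty.mpr (fun h => hAB (symmDiff_eq_bot.mp h)))
    have e1 : symmDiff A ({i} ∪ symmDiff A B) = insert i B := by
      ext x; by_cases hx : x = i
      · subst hx; simp [Finset.mem_symmDiff, hA]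
      · simp [Finset.mem_symmDiff, hx]; tauto
    have e2 : symmDiff A {i} = insert i A := by
      ext x; by_cases hx : x = i
      · subst hx; simp [Finset.mem_symmDiff, hA]
      · simp [Finset.mem_symmDiff, hx]
    have e3 : symmDiff A (symmDiff A B) = B := by simp
    rw [e1, e2, e3] at hr
    obtain ⟨q, ⟨a, b, ha, hb, hab, h1⟩, ⟨c, d, hc, hd, hcd, h2⟩⟩ := hr
    refine ⟨a • ((1 : ℝ), w A) - c • ((1 : ℝ), w (insert i A)), ?_, ?_, ?_⟩
    · intro h0
      have f1 : a - c = 0 := by simpa using congrArg Prod.fst h0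
      have f2 : a • w A - c • w (insert i A) = 0 := by simpa using congrArg Prod.snd h0
      have : c = a := by linarith
      subst this
      rw [← smul_sub, smul_eq_zero] at f2
      rcases f2 with f2 | f2
      · exact ha.ne' f2
      · exact hdist A hA (sub_eq_zero.mp f2)
    · exact sub_mem (Submodule.smul_mem _ _ (Submodule.subset_span (by simp)))
        (Submodule.smul_mem _ _ (Submodule.subset_span (by simp)))
    · have : a • ((1 : ℝ), w A) - c • ((1 : ℝ), w (insert i A))
          = d • ((1 : ℝ), w B) - b • ((1 : ℝ), w (insert i B)) := by
        refine Prod.ext ?_ ?_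
        · simp; linarith
        · simp only [Prod.snd_sub, Prod.smul_snd]
          rw [sub_eq_sub_iff_add_eq_add, h1, add_comm, ← h2, add_comm]
          try abel
      rw [this]
      exact sub_mem (Submodule.smul_mem _ _ (Submodule.subset_span (by simp)))
        (Submodule.smul_mem _ _ (Submodule.subset_span (by simp)))
  have hcommon : ∃ v, v ≠ 0 ∧ ∀ a, v ∈ L a := by
    rcases Nat.lt_or_ge 2 n with h3 | h3
    · refine cube_aux_common L hL hpair ?_
      intro U hU
      have hmem : ∀ B, ((1 : ℝ), w B) ∈ U := by
        intro B
        by_cases hB : i ∈ B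
        · have := hU ⟨B.erase i, by simp⟩ (Submodule.subset_span (Set.mem_insert_of_mem _ rfl))
          simpa [Finset.insert_erase hB] using this
        · exact hU ⟨B, hB⟩ (Submodule.subset_span (Set.mem_insert _ _))
      let f : (Fin n → ℝ) →ᵃ[ℝ] (ℝ × (Fin n → ℝ)) :=
        (AffineMap.const ℝ (Fin n → ℝ) (1 : ℝ)).prod (AffineMap.id ℝ (Fin n → ℝ))
      have hle : affineSpan ℝ (Set.range w) ≤ U.toAffineSubspace.comap f := by
        rw [affineSpan_le]
        rintro _ ⟨B, rfl⟩
        exact hmem B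
      have hall : ∀ x, ((1 : ℝ), x) ∈ U := by
        intro x
        have : x ∈ affineSpan ℝ (Set.range w) := by rw [hw.span_top]; trivial
        exact hle this
      have htop : U = ⊤ := by
        rw [eq_top_iff]
        rintro ⟨t, x⟩ -
        have := add_mem (U.smul_mem (t - 1) (hall 0)) (hall x)
        simpa using this
      rw [htop, finrank_top, Module.finrank_prod]
      simp
      omega
    · have hn2 : n = 2 := le_antisymm h3 hn
      subst hn2
      obtain ⟨v, hv, hv1, hv2⟩ := hpair ⟨∅, by simp⟩ ⟨{1 - i}, by fin_cases i <;> simp⟩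
      refine ⟨v, hv, ?_⟩
      rintro ⟨A, hA⟩
      have : A = ∅ ∨ A = {1 - i} := by
        clear hv1 hv2 hpair hdist hL L
        revert i A; decide
      rcases this with rfl | rfl
      · exact hv1
      · exact hv2
  obtain ⟨⟨t, u⟩, hv, hvL⟩ := hcommon
  have hco : ∀ A, i ∉ A → ∃ α β : ℝ, α + β = t ∧ α • w A + β • w (insert i A) = u := by
    intro A hA
    obtain ⟨α, β, h⟩ := Submodule.mem_span_pair.mp (hvL ⟨A, hA⟩)
    exact ⟨α, β, by simpa using congrArg Prod.fst h, by simpa using congrArg Prod.snd h⟩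
  by_cases ht : t = 0
  · right
    subst ht
    have hu : u ≠ 0 := by
      rintro rfl
      exact hv rfl
    have hco' : ∀ A, i ∉ A → ∃ β : ℝ, w (insert i A) - w A = β • u := by
      intro A hA
      obtain ⟨α, β, h1, h2⟩ := hco A hA
      have hα : α = -β := by linarith
      subst hα
      have h3 : β • (w (insert i A) - w A) = u := by rw [← h2]; module
      have hβ : β ≠ 0 := by
        rintro rfl
        simp at h3
        exact hu h3.symm
      exact ⟨β⁻¹, by rw [← h3, smul_smul, inv_mul_cancel₀ hβ, one_smul]⟩
    intro A B hA hB hli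
    obtain ⟨a, ha⟩ := hco' A hA
    obtain ⟨b, hb⟩ := hco' B hB
    rw [LinearIndependent.pair_iff] at hli
    have h := hli b (-a) (by rw [ha, hb]; module)
    have hz : a = 0 := by linarith [h.2]
    rw [hz, zero_smul] at ha
    exact hdist A hA (sub_eq_zero.mp ha).symm
  · left
    refine ⟨t⁻¹ • u, fun A hA => ?_⟩
    obtain ⟨α, β, h1, h2⟩ := hco A hA
    have : t⁻¹ • u = AffineMap.lineMap (w A) (w (insert i A)) (t⁻¹ * β) := by
      rw [AffineMap.lineMap_apply_module, ← h2, smul_add, smul_smul, smul_smul]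
      congr 2
      field_simp
      linarith
    rw [this]
    exact AffineMap.lineMap_mem_affineSpan_pair _ _ _
end
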